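/- (Proposition 3.4) Assume 0<h<2 with 2/h∉ℤ, h small and L large; set λ=⌊2/h⌋+1. Let ζ∈{+1̲,C_e,C_o} and let η be the trap that equals ζ inside the interior of a rectangle R_{ℓ,m} with 2≤ℓ≤m≤L−2 and equals −1̲ outside. (i) If ℓ<λ then η is subcritical: ℙ_η(τ_{−1̲}<τ_{𝒮_𝒞∪𝒮_{+1̲}})→1 as β→∞, and for every ε>0, ℙ_η( exp{2βh(ℓ−1)−βε} < τ_{−1̲} < exp{2βh(ℓ−1)+βε} )→1. (ii) If ℓ≥λ then η is supercritical: ℙ_η(τ_{𝒮_𝒞∪𝒮_{+1̲}}<τ_{−1̲})→1, and for every ε>0, ℙ_η( exp{2β(2−h)−βε} < τ_{𝒮_𝒞∪𝒮_{+1̲}} < exp{2β(2−h)+βε} )→1. -/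

import Mathlib

open scoped BigOperators Classical
open Filter

namespace PCA

/-- Sites of the two-dimensional discrete torus of side `L`. -/
abbrev Site (L : ℕ) := ZMod L × ZMod L

/-- Spin configurations: `true` codes the spin `+1`, `false` codes `-1`. -/
abbrev Config (L : ℕ) := Site L → Bool

noncomputable section

/-- The real value of a spin. -/
def spin (b : Bool) : ℝ := if b then 1 else -1

def east (L : ℕ) : Site L := (1, 0)
def north (L : ℕ) : Site L := (0, 1)

variable {L : ℕ}

/-- `S_σ(x)`: the sum of the spins of the four nearest neighbours of `x`. -/
def nnS (σ : Config L) (x : Site L) : ℝ :=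
  spin (σ (x + east L)) + spin (σ (x - east L)) +
    spin (σ (x + north L)) + spin (σ (x - north L))

/-- Single-site heat-bath probability `p_x(a|σ)`. -/
def flipP (β h : ℝ) (σ : Config L) (x : Site L) (a : Bool) : ℝ :=
  1 / (1 + Real.exp (-2 * β * spin a * (nnS σ x + h)))

/-- The PCA transition matrix `P(σ,η) = ∏_x p_x(η(x)|σ)`. -/
def Pmat (β h : ℝ) [NeZero L] (σ η : Config L) : ℝ :=
  ∏ x : Site L, flipP β h σ x (η x)

/-- The four-body Hamiltonian `H_β`. -/
def Ham (β h : ℝ) [NeZero L] (σ : Config L) : ℝ :=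
  -(β * h) * ∑ x : Site L, spin (σ x)
    - ∑ x : Site L, Real.log (Real.cosh (β * (nnS σ x + h)))

/-- The zero-temperature energy `E`. -/
def En (h : ℝ) [NeZero L] (σ : Config L) : ℝ :=
  -h * ∑ x : Site L, spin (σ x) - ∑ x : Site L, |nnS σ x + h|

/-- The zero-temperature drift map `T`. -/
def T (h : ℝ) (σ : Config L) : Config L :=
  fun x => if 0 < nnS σ x + h then true else false

def plusC (L : ℕ) : Config L := fun _ => true
def minusC (L : ℕ) : Config L := fun _ => false

/-- The even chessboard `C_e(x) = (-1)^(x₁+x₂)` (`true` at even-parity sites). -/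
def chessE (L : ℕ) : Config L := fun x => decide ((x.1 + x.2).val % 2 = 0)
def chessO (L : ℕ) : Config L := fun x => !(chessE L x)
def chessSet (L : ℕ) : Set (Config L) := {chessE L, chessO L}

def IsChessCfg {L : ℕ} (C : Config L) : Prop := C = chessE L ∨ C = chessO L

/-- A trap: a stable configuration or an element of a stable pair. -/
def IsTrap (h : ℝ) (σ : Config L) : Prop := T h σ = σ ∨ T h (T h σ) = σ

/-- The trap `σ̂` reached by the downhill path started at `σ`. -/
def hatTrap (h : ℝ) (σ : Config L) : Config L :=
  (T h)^[sInf {n | IsTrap h ((T h)^[n] σ)}] σ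

/-- The basin of attraction `𝔅(ζ)` of a trap `ζ`. -/
def basin (h : ℝ) (ζ : Config L) : Set (Config L) := {σ | hatTrap h σ = ζ}

/-- The interior of a rectangle on the dual lattice: an `a × b` block of sites
with lower-left corner `c`. -/
def rect (c : Site L) (a b : ℕ) : Set (Site L) :=
  { y | ∃ i j : ℕ, i < a ∧ j < b ∧ y = c + ((i : ZMod L), (j : ZMod L)) }

/-- The configuration equal to `ζ` inside the given rectangle and to `bg` outside. -/
def rectCfg (bg ζ : Config L) (c : Site L) (a b : ℕ) : Config L :=
  fun x => if x ∈ rect c a b then ζ x else bg x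

/-- Differences between sites at euclidean distance at most `2` on the torus. -/
def closeDiff (d : Site L) : Prop :=
  ∃ u v : ℤ, u ^ 2 + v ^ 2 ≤ 4 ∧ d = ((u : ZMod L), (v : ZMod L))

/-- Two sets of sites are non-interacting iff all pairs of sites are at
euclidean distance `> 2` (equivalently `≥ √5`). -/
def NonInteracting (A B : Set (Site L)) : Prop :=
  ∀ x ∈ A, ∀ y ∈ B, ¬ closeDiff (y - x)

/-- Nearest-neighbour adjacency on the torus. -/
def Adj (x y : Site L) : Prop :=
  y = x + east L ∨ y = x - east L ∨ y = x + north L ∨ y = x - north L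

def stepSet : Set (ℤ × ℤ) := {(1, 0), (-1, 0), (0, 1), (0, -1)}

/-- `X` contains a nearest-neighbour loop winding around the torus
(a percolating, torus-wrapping, cluster is a cluster containing such a loop). -/
def Wrapping (X : Set (Site L)) : Prop :=
  ∃ (n : ℕ) (f : ℕ → Site L) (d : ℕ → ℤ × ℤ),
    0 < n ∧ f n = f 0 ∧ (∑ i ∈ Finset.range n, d i) ≠ 0 ∧
    ∀ i < n, d i ∈ stepSet ∧
      f (i + 1) = f i + (((d i).1 : ZMod L), ((d i).2 : ZMod L)) ∧ f i ∈ X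

/-- `σ` has a well defined sea of the homogeneous phase `α`. -/
def SeaHom (h : ℝ) (α σ : Config L) : Prop :=
  ∃ X : Set (Site L), Wrapping X ∧ (∀ x ∈ X, σ x = α x) ∧
    ∀ n : ℕ, 1 ≤ n → ∀ x ∈ X, (T h)^[n] σ x = α x

/-- `σ` has a well defined sea of the chessboard `C`. -/
def SeaChess (h : ℝ) (C σ : Config L) : Prop :=
  ∃ X : Set (Site L), Wrapping X ∧ (∀ x ∈ X, σ x = C x) ∧
    ∀ n : ℕ, 1 ≤ n → ∀ x ∈ X, (T h)^[2 * n] σ x = C x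

def SeaMinus (h : ℝ) (σ : Config L) : Prop := SeaHom h (minusC L) σ
def SeaPlus (h : ℝ) (σ : Config L) : Prop := SeaHom h (plusC L) σ
def SeaChessAny (h : ℝ) (σ : Config L) : Prop :=
  SeaChess h (chessE L) σ ∨ SeaChess h (chessO L) σ

/-- Communication height `H(σ,η) = H(σ) - log P(σ,η)`. -/
def commH (β h : ℝ) [NeZero L] (σ η : Config L) : ℝ :=
  Ham β h σ - Real.log (Pmat β h σ η)

/-- Minimal height (minmax) `Φ(σ,η)` over all paths from `σ` to `η`. -/
def Phi (β h : ℝ) [NeZero L] (σ η : Config L) : ℝ :=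
  sInf { v | ∃ (n : ℕ) (f : ℕ → Config L), 0 < n ∧ f 0 = σ ∧ f n = η ∧
    v = sSup { w | ∃ i < n, w = commH β h (f i) (f (i + 1)) } }

/-- The barrier `Υ(η) = min_{ζ ∉ 𝔅(η)} Φ(η,ζ)` to exit the basin of the trap `η`. -/
def Ups (β h : ℝ) [NeZero L] (η : Config L) : ℝ :=
  sInf { v | ∃ ζ : Config L, ζ ∉ basin h η ∧ v = Phi β h η ζ }

/-- Probability, starting from `σ0`, that the first visit to `E` happens
at time `n` and at a state of `F`. -/
def firstHitP (β h : ℝ) [NeZero L] (σ0 : Config L) (E F : Set (Config L)) (n : ℕ) : ℝ :=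
  ∑ f : Fin (n + 1) → Config L,
    if f 0 = σ0 ∧ (∀ i : Fin (n + 1), (i : ℕ) < n → f i ∉ E) ∧ f (Fin.last n) ∈ E ∩ F
    then ∏ i : Fin n, Pmat β h (f i.castSucc) (f i.succ) else 0

/-- `ℙ_{σ0}(τ_A < τ_B)`. -/
def probHitBefore (β h : ℝ) [NeZero L] (σ0 : Config L) (A B : Set (Config L)) : ℝ :=
  ∑' n : ℕ, firstHitP β h σ0 (A ∪ B) (A \ B) n

/-- `ℙ_{σ0}(τ_D ∈ I)` (for `τ_D < ∞`). -/
def probTauIn (β h : ℝ) [NeZero L] (σ0 : Config L) (D : Set (Config L)) (I : Set ℝ) : ℝ :=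
  ∑' n : ℕ, if (n : ℝ) ∈ I then firstHitP β h σ0 D Set.univ n else 0

/-- `ℙ_{σ0}(τ_D > t)` (including the event that `D` is never visited). -/
def probTauGT (β h : ℝ) [NeZero L] (σ0 : Config L) (D : Set (Config L)) (t : ℝ) : ℝ :=
  1 - probTauIn β h σ0 D (Set.Iic t)

/-- `ℙ_{σ0}(σ_{τ_E} ∈ F)`. -/
def probFirstHitIn (β h : ℝ) [NeZero L] (σ0 : Config L) (E F : Set (Config L)) : ℝ :=
  ∑' n : ℕ, firstHitP β h σ0 E F n

/-- The critical length `λ = ⌊2/h⌋ + 1`. -/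
def lam (h : ℝ) : ℕ := Nat.floor (2 / h) + 1

/-- The protocritical height `Γ = -2hλ² + 2λ(4+h) - 2h`. -/
def Gam (h : ℝ) : ℝ :=
  -2 * h * (lam h : ℝ) ^ 2 + 2 * (lam h : ℝ) * (4 + h) - 2 * h

/-- The geometric conditions of Proposition 3.3 (iii) for a trap in the sea of
minuses, with `s` chessboard rectangles (indices `< s`) and `k - s` plus
rectangles (indices `≥ s`). -/
def MinusMultiSpec (h : ℝ) (σ : Config L) (s : ℕ) {k : ℕ}
    (c : Fin k → Site L) (a b : Fin k → ℕ) : Prop :=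
  1 ≤ k ∧ s ≤ k ∧
  (∀ i, 2 ≤ min (a i) (b i) ∧ max (a i) (b i) ≤ L - 2) ∧
  (∀ i j, i ≠ j → Disjoint (rect (c i) (a i) (b i)) (rect (c j) (a j) (b j))) ∧
  (∀ j i : Fin k, (j : ℕ) < s → s ≤ (i : ℕ) →
    NonInteracting (rect (c j) (a j) (b j)) (rect (c i) (a i) (b i))) ∧
  (∀ i j : Fin k, s ≤ (i : ℕ) → s ≤ (j : ℕ) → i ≠ j →
    NonInteracting (rect (c i) (a i) (b i)) (rect (c j) (a j) (b j))) ∧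
  (∀ x, (∀ i, x ∉ rect (c i) (a i) (b i)) → σ x = false) ∧
  (∀ i : Fin k, s ≤ (i : ℕ) → ∀ x ∈ rect (c i) (a i) (b i), σ x = true) ∧
  ∃ Cp : Fin k → Config L,
    (∀ j : Fin k, (j : ℕ) < s → IsChessCfg (Cp j) ∧
      ∃ (k' : ℕ) (c' : Fin k' → Site L) (a' b' : Fin k' → ℕ),
        (∀ i, rect (c' i) (a' i) (b' i) ⊆ rect (c j) (a j) (b j)) ∧
        (∀ i i', i ≠ i' →
          NonInteracting (rect (c' i) (a' i) (b' i)) (rect (c' i') (a' i') (b' i'))) ∧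
        (∀ i, ∀ x ∈ rect (c' i) (a' i) (b' i), σ x = true) ∧
        (∀ x ∈ rect (c j) (a j) (b j),
          (∀ i, x ∉ rect (c' i) (a' i) (b' i)) → σ x = Cp j x)) ∧
    (∀ i j : Fin k, (i : ℕ) < s → (j : ℕ) < s → i ≠ j → Cp i = Cp j →
      NonInteracting (rect (c i) (a i) (b i)) (rect (c j) (a j) (b j)))

/-- `η ∈ 𝒪_{-1}` (a `(λ-1) × λ` chessboard droplet in the sea of minuses) and
`ζ ∈ π_{-1}(η)` is one of its protocritical droplets. -/
def ProtoRel (h : ℝ) (η ζ : Config L) : Prop :=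
  ∃ (c : Site L) (a b : ℕ) (C : Config L) (y z : Site L),
    IsChessCfg C ∧
    ((a = lam h - 1 ∧ b = lam h) ∨ (a = lam h ∧ b = lam h - 1)) ∧
    (∀ x ∈ rect c a b, η x = C x) ∧ (∀ x ∉ rect c a b, η x = false) ∧
    y ∉ rect c a b ∧ z ∈ rect c a b ∧ Adj y z ∧ C z = true ∧
    (∀ x ∈ rect c a b, ζ x = !(C x)) ∧ ζ y = true ∧
    (∀ x, x ∉ rect c a b → x ≠ y → ζ x = false)

/-- The set `𝒪_{-1}` of `(λ-1) × λ` chessboard droplets in the sea of minuses. -/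
def OSet (h : ℝ) (L : ℕ) : Set (Config L) :=
  { η | ∃ (c : Site L) (a b : ℕ) (C : Config L),
      IsChessCfg C ∧ ((a = lam h - 1 ∧ b = lam h) ∨ (a = lam h ∧ b = lam h - 1)) ∧
      (∀ x ∈ rect c a b, η x = C x) ∧ (∀ x ∉ rect c a b, η x = false) }

/-- The set `𝒫_{-1}` of protocritical droplets. -/
def ProtoSet (h : ℝ) (L : ℕ) : Set (Config L) := { ζ | ∃ η, ProtoRel h η ζ }

end



section MarkovOperators

variable {Ω : Type*}

/-- The real-valued indicator of a set of states. -/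
noncomputable def ind (G : Set Ω) : Ω → ℝ := fun ω => if ω ∈ G then 1 else 0

lemma ind_nonneg (G : Set Ω) (ω : Ω) : 0 ≤ ind G ω := by
  unfold ind; split_ifs <;> norm_num

lemma ind_le_one (G : Set Ω) (ω : Ω) : ind G ω ≤ 1 := by
  unfold ind; split_ifs <;> norm_num

lemma ind_mono {G G' : Set Ω} (hG : G ⊆ G') : ind G ≤ ind G' := by
  intro ω
  by_cases hω : ω ∈ G
  · simp [ind, hω, hG hω]
  · simp [ind, hω]; split_ifs <;> norm_num

lemma ind_compl (G : Set Ω) : ind Gᶜ = 1 - ind G := by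
  funext ω
  by_cases hω : ω ∈ G <;> simp [ind, hω]

/-- A Markov operator: a positive linear operator fixing the constant function `1`. -/
structure IsMarkov (Q : Module.End ℝ (Ω → ℝ)) : Prop where
  mono : ∀ f g : Ω → ℝ, f ≤ g → Q f ≤ Q g
  map_one : Q 1 = 1

namespace IsMarkov

variable {Q : Module.End ℝ (Ω → ℝ)}

lemma mul {Q' : Module.End ℝ (Ω → ℝ)} (hQ : IsMarkov Q) (hQ' : IsMarkov Q') :
    IsMarkov (Q * Q') :=
  ⟨fun f g hfg => hQ.mono _ _ (hQ'.mono f g hfg), by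
    rw [Module.End.mul_apply, hQ'.map_one, hQ.map_one]⟩

lemma pow (hQ : IsMarkov Q) (n : ℕ) : IsMarkov (Q ^ n) := by
  induction n with
  | zero => exact ⟨fun f g hfg => hfg, rfl⟩
  | succ n ih => rw [pow_succ]; exact ih.mul hQ

lemma nonneg (hQ : IsMarkov Q) {f : Ω → ℝ} (hf : 0 ≤ f) : 0 ≤ Q f := by
  have h := hQ.mono 0 f hf
  rwa [map_zero] at h

lemma ind_nonneg (hQ : IsMarkov Q) (G : Set Ω) (ω : Ω) : 0 ≤ Q (ind G) ω :=
  hQ.nonneg (PCA.ind_nonneg G) ω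

lemma le_one (hQ : IsMarkov Q) {f : Ω → ℝ} (hf : f ≤ 1) (ω : Ω) : Q f ω ≤ 1 := by
  have h := hQ.mono f 1 hf
  rw [hQ.map_one] at h
  exact h ω

lemma ind_le_one (hQ : IsMarkov Q) (G : Set Ω) (ω : Ω) : Q (ind G) ω ≤ 1 :=
  hQ.le_one (fun ω => PCA.ind_le_one G ω) ω

lemma apply_compl (hQ : IsMarkov Q) (G : Set Ω) (ω : Ω) :
    Q (ind Gᶜ) ω = 1 - Q (ind G) ω := by
  rw [ind_compl, map_sub, hQ.map_one]; rfl

/-- Bounding a function by a constant plus a multiple of another one. -/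
lemma le_const_add (hQ : IsMarkov Q) {f g : Ω → ℝ} {a : ℝ}
    (hfg : ∀ ω, f ω ≤ a + g ω) (ω : Ω) : Q f ω ≤ a + Q g ω := by
  have h := hQ.mono f (a • (1 : Ω → ℝ) + g) (fun ω => by simpa using hfg ω)
  rw [map_add, map_smul, hQ.map_one] at h
  simpa using h ω

lemma le_of_le_const (hQ : IsMarkov Q) {f : Ω → ℝ} {a : ℝ} (hf : ∀ ω, f ω ≤ a) (ω : Ω) :
    Q f ω ≤ a := by
  have h := hQ.le_const_add (f := f) (g := 0) (a := a) (fun ω => by simpa using hf ω) ω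
  simpa using h

/-- If the sets `I n` are left with probability at most `q` at each step, then they are
left with probability at most `n * q` in `n` steps. -/
lemma stay (hQ : IsMarkov Q) {I : ℕ → Set Ω} {q : ℝ}
    (hI : ∀ n, ∀ ω ∈ I n, Q (ind (I (n + 1))ᶜ) ω ≤ q) (n : ℕ) :
    ∀ k, ∀ ω ∈ I k, (Q ^ n) (ind (I (k + n))ᶜ) ω ≤ n * q := by
  induction n with
  | zero => intro k ω hω; simp [ind, hω]
  | succ n ih =>
    intro k ω hω
    have hq : 0 ≤ q := (hQ.ind_nonneg _ _).trans (hI k ω hω)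
    rw [pow_succ', Module.End.mul_apply]
    have key : ∀ ω', (Q ^ n) (ind (I (k + (n + 1)))ᶜ) ω' ≤ n * q + ind (I (k + 1))ᶜ ω' := by
      intro ω'
      by_cases h' : ω' ∈ I (k + 1)
      · have := ih (k + 1) ω' h'
        rw [show k + 1 + n = k + (n + 1) by ring] at this
        simpa [ind, h'] using this
      · have := (hQ.pow n).ind_le_one (I (k + (n + 1)))ᶜ ω'
        have h0 : 0 ≤ (n : ℝ) * q := by positivity
        simp only [ind, Set.mem_compl_iff, h', not_false_eq_true, if_true] at this ⊢
        linarith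
    have := hQ.le_const_add key ω
    have h2 := hI k ω hω
    push_cast
    linarith

/-- The operator killed upon visiting `G`. -/
noncomputable def killed (Q : Module.End ℝ (Ω → ℝ)) (G : Set Ω) : Module.End ℝ (Ω → ℝ) where
  toFun f := fun ω => ind Gᶜ ω * Q f ω
  map_add' f g := by funext ω; simp [mul_add]
  map_smul' c f := by funext ω; simp; ring

lemma killed_apply (Q : Module.End ℝ (Ω → ℝ)) (G : Set Ω) (f : Ω → ℝ) (ω : Ω) :
    killed Q G f ω = ind Gᶜ ω * Q f ω := rfl

lemma killed_pow_mono (hQ : IsMarkov Q) (G : Set Ω) (n : ℕ) {f g : Ω → ℝ} (hfg : f ≤ g) :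
    (killed Q G ^ n) f ≤ (killed Q G ^ n) g := by
  induction n with
  | zero => exact hfg
  | succ n ih =>
    rw [pow_succ', Module.End.mul_apply, Module.End.mul_apply]
    intro ω
    exact mul_le_mul_of_nonneg_left (hQ.mono _ _ ih ω) (PCA.ind_nonneg _ _)

lemma killed_pow_le (hQ : IsMarkov Q) (G : Set Ω) (n : ℕ) {f : Ω → ℝ} (hf : 0 ≤ f) :
    (killed Q G ^ n) f ≤ (Q ^ n) f := by
  induction n with
  | zero => exact le_rfl
  | succ n ih =>
    rw [pow_succ', pow_succ', Module.End.mul_apply, Module.End.mul_apply]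
    intro ω
    calc ind Gᶜ ω * Q ((killed Q G ^ n) f) ω
        ≤ ind Gᶜ ω * Q ((Q ^ n) f) ω :=
          mul_le_mul_of_nonneg_left (hQ.mono _ _ ih ω) (PCA.ind_nonneg _ _)
      _ ≤ 1 * Q ((Q ^ n) f) ω :=
          mul_le_mul_of_nonneg_right (PCA.ind_le_one _ _) (hQ.nonneg ((hQ.pow n).nonneg hf) ω)
      _ = _ := one_mul _

/-- Metastable relaxation: if both `G` and `G'` are stable up to an error `δ` on the time
scale `N`, and `G'` is reached from `G` in one step with probability at least `p`, then after
`N` steps the chain started in `G` is in `G'` up to an error `(1 - p) ^ N + 2 * δ`. -/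
lemma relax (hQ : IsMarkov Q) {G G' : Set Ω} {N : ℕ} {p δ : ℝ} (hp0 : 0 ≤ p) (hp1 : p ≤ 1)
    (hδ : 0 ≤ δ)
    (hG : ∀ n ≤ N, ∀ ω ∈ G, (Q ^ n) (ind Gᶜ) ω ≤ δ)
    (hG' : ∀ n ≤ N, ∀ ω ∈ G', (Q ^ n) (ind G'ᶜ) ω ≤ δ)
    (hp : ∀ ω ∈ G, Q (ind G'ᶜ) ω ≤ 1 - p) :
    ∀ ω ∈ G, (Q ^ N) (ind G'ᶜ) ω ≤ (1 - p) ^ N + 2 * δ := by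
  intro ω hω
  have hone : killed Q G' (ind G'ᶜ) ≤ (1 - p) • ind G'ᶜ + p • ind Gᶜ := by
    intro ω'
    have hle := hQ.ind_le_one G'ᶜ ω'
    by_cases h1 : ω' ∈ G'
    · simp only [killed, LinearMap.coe_mk, AddHom.coe_mk, Pi.add_apply, Pi.smul_apply, smul_eq_mul]
      have := PCA.ind_nonneg Gᶜ ω'
      simp only [ind, Set.mem_compl_iff, h1, not_true_eq_false, if_false] at this ⊢
      nlinarith
    · by_cases h2 : ω' ∈ G
      · have := hp ω' h2
        simp only [killed, LinearMap.coe_mk, AddHom.coe_mk, Pi.add_apply, Pi.smul_apply,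
          smul_eq_mul]
        simp only [ind, Set.mem_compl_iff, h1, h2, not_false_eq_true, not_true_eq_false,
          if_true, if_false] at this ⊢
        linarith
      · simp only [killed, LinearMap.coe_mk, AddHom.coe_mk, Pi.add_apply, Pi.smul_apply,
          smul_eq_mul]
        simp only [ind, Set.mem_compl_iff, h1, h2, not_false_eq_true, if_true] at hle ⊢
        linarith
  have hv : ∀ n ≤ N, (killed Q G' ^ n) (ind G'ᶜ) ω ≤ (1 - p) ^ n + δ := by
    intro n
    induction n with
    | zero =>
      intro _
      have := PCA.ind_le_one G'ᶜ ω
      simp only [pow_zero, Module.End.one_apply]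
      linarith
    | succ n ih =>
      intro hn
      have ih' := ih (by omega)
      have h1 := hQ.killed_pow_mono G' n hone ω
      rw [map_add, map_smul, map_smul] at h1
      have h2 := hQ.killed_pow_le G' n (f := ind Gᶜ) (PCA.ind_nonneg _) ω
      have h3 := hG n (by omega) ω hω
      rw [pow_succ, Module.End.mul_apply]
      simp only [Pi.add_apply, Pi.smul_apply, smul_eq_mul] at h1
      have h4 : (1 - p) * (killed Q G' ^ n) (ind G'ᶜ) ω ≤ (1 - p) * ((1 - p) ^ n + δ) :=
        mul_le_mul_of_nonneg_left ih' (by linarith)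
      have h5 : p * (killed Q G' ^ n) (ind Gᶜ) ω ≤ p * δ :=
        mul_le_mul_of_nonneg_left (h2.trans h3) hp0
      calc _ ≤ _ := h1
        _ ≤ (1 - p) * ((1 - p) ^ n + δ) + p * δ := add_le_add h4 h5
        _ = (1 - p) ^ (n + 1) + δ := by ring
  have hw : ∀ n ≤ N, ∀ ω', (Q ^ n) (ind G'ᶜ) ω' ≤ δ + (killed Q G' ^ n) (ind G'ᶜ) ω' := by
    intro n
    induction n with
    | zero => intro _ ω'; simp only [pow_zero, Module.End.one_apply]; linarith
    | succ n ih =>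
      intro hn ω'
      by_cases h1 : ω' ∈ G'
      · have h2 := hG' (n + 1) hn ω' h1
        have h3 := hQ.killed_pow_mono G' (n + 1) (f := 0) (g := ind G'ᶜ) (PCA.ind_nonneg _) ω'
        rw [map_zero] at h3
        have h4 : (0 : ℝ) ≤ (killed Q G' ^ (n + 1)) (ind G'ᶜ) ω' := h3
        linarith
      · have h2 := hQ.le_const_add (ih (by omega)) ω'
        rw [pow_succ', pow_succ', Module.End.mul_apply, Module.End.mul_apply]
        have h3 : killed Q G' ((killed Q G' ^ n) (ind G'ᶜ)) ω'
            = Q ((killed Q G' ^ n) (ind G'ᶜ)) ω' := by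
          rw [killed_apply]
          simp [ind, h1]
        rw [h3]
        exact h2
  have h1 := hw N le_rfl ω
  have h2 := hv N le_rfl
  linarith

/-- Composition of successive stages, each of which fails with probability at most `ρ`. -/
lemma chain (hQ : IsMarkov Q) {G : ℕ → Set Ω} {S : ℕ} {ρ : ℝ}
    (hG : ∀ i < S, ∀ ω ∈ G i, Q (ind (G (i + 1))ᶜ) ω ≤ ρ) :
    ∀ ω ∈ G 0, (Q ^ S) (ind (G S)ᶜ) ω ≤ S * ρ := by
  induction S with
  | zero => intro ω hω; simp [ind, hω]
  | succ S ih =>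
    intro ω hω
    have h1 := ih (fun i hi => hG i (by omega)) ω hω
    rw [pow_succ, Module.End.mul_apply]
    by_cases hne : (G S).Nonempty
    · obtain ⟨ω₀, hω₀⟩ := hne
      have hρ : 0 ≤ ρ := (hQ.ind_nonneg _ _).trans (hG S (by omega) ω₀ hω₀)
      have h2 := (hQ.pow S).le_const_add (f := Q (ind (G (S + 1))ᶜ)) (g := ind (G S)ᶜ) (a := ρ)
        (fun ω' => by
          by_cases h' : ω' ∈ G S
          · have := hG S (by omega) ω' h'
            simpa [ind, h'] using this
          · have := hQ.ind_le_one (G (S + 1))ᶜ ω'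
            simp only [ind, Set.mem_compl_iff, h', not_false_eq_true, if_true] at this ⊢
            linarith) ω
      push_cast
      linarith
    · have h3 : ind (G S)ᶜ = (1 : Ω → ℝ) := by
        rw [Set.not_nonempty_iff_eq_empty.mp hne]; funext x; simp [ind]
      rw [h3, (hQ.pow S).map_one] at h1
      have h4 := (hQ.pow S).le_one (f := Q (ind (G (S + 1))ᶜ)) (fun ω' => hQ.ind_le_one _ ω') ω
      have h5 : (1 : ℝ) ≤ S * ρ := h1
      have h6 : 0 ≤ ρ := by
        by_contra hneg
        push Not at hneg
        have : (S : ℝ) * ρ ≤ 0 := mul_nonpos_of_nonneg_of_nonpos (by positivity) hneg.le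
        linarith
      push_cast
      linarith

/-- Lower bounds on transition probabilities between sets compose. -/
lemma lower_comp {Q' : Module.End ℝ (Ω → ℝ)} (hQ : IsMarkov Q)
    {G G' G'' : Set Ω} {c c' : ℝ} (hc' : 0 ≤ c')
    (h1 : ∀ ω ∈ G, c ≤ Q (ind G') ω) (h2 : ∀ ω ∈ G', c' ≤ Q' (ind G'') ω)
    (hQ' : IsMarkov Q') :
    ∀ ω ∈ G, c * c' ≤ (Q * Q') (ind G'') ω := by
  intro ω hω
  have h3 := hQ.mono (c' • ind G') (Q' (ind G'')) (fun ω' => by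
    by_cases h' : ω' ∈ G'
    · simpa [ind, h'] using h2 ω' h'
    · simpa [ind, h'] using hQ'.ind_nonneg G'' ω') ω
  rw [map_smul] at h3
  have h4 := mul_le_mul_of_nonneg_right (h1 ω hω) hc'
  simp only [Pi.smul_apply, smul_eq_mul] at h3
  rw [Module.End.mul_apply]
  linarith

end IsMarkov

/-- Probability of having visited `E` by time `n`. -/
noncomputable def hitBy (Q : Module.End ℝ (Ω → ℝ)) (E : Set Ω) : ℕ → Ω → ℝ
  | 0 => ind E
  | n + 1 => fun ω => if ω ∈ E then 1 else Q (hitBy Q E n) ω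

/-- Probability that the first visit to `E` occurs at time `n` and in `F`. -/
noncomputable def firstHit (Q : Module.End ℝ (Ω → ℝ)) (E F : Set Ω) : ℕ → Ω → ℝ
  | 0 => ind (E ∩ F)
  | n + 1 => fun ω => if ω ∈ E then 0 else Q (firstHit Q E F n) ω


section Hitting

variable {Q : Module.End ℝ (Ω → ℝ)}

lemma firstHit_nonneg (hQ : IsMarkov Q) (E F : Set Ω) (n : ℕ) : 0 ≤ firstHit Q E F n := by
  induction n with
  | zero => exact ind_nonneg _
  | succ n ih =>
    intro ω
    simp only [firstHit]
    split_ifs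
    · exact le_rfl
    · exact hQ.nonneg ih ω

lemma sum_firstHit_succ (Q : Module.End ℝ (Ω → ℝ)) (E F : Set Ω) (N : ℕ) (ω : Ω) :
    ∑ n ∈ Finset.range (N + 2), firstHit Q E F n ω
      = if ω ∈ E then ind F ω else Q (∑ n ∈ Finset.range (N + 1), firstHit Q E F n) ω := by
  rw [Finset.sum_range_succ']
  by_cases hω : ω ∈ E
  · simp [firstHit, ind, hω]
  · simp [firstHit, ind, hω, map_sum]

lemma sum_firstHit_univ (Q : Module.End ℝ (Ω → ℝ)) (E : Set Ω) (N : ℕ) :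
    ∀ ω, ∑ n ∈ Finset.range (N + 1), firstHit Q E Set.univ n ω = hitBy Q E N ω := by
  induction N with
  | zero => intro ω; simp [firstHit, hitBy]
  | succ N ih =>
    intro ω
    rw [sum_firstHit_succ]
    have : ∑ n ∈ Finset.range (N + 1), firstHit Q E Set.univ n = hitBy Q E N := by
      funext ω'; rw [Finset.sum_apply]; exact ih ω'
    rw [this]
    by_cases hω : ω ∈ E <;> simp [hitBy, ind, hω]

lemma sum_firstHit_le_one (hQ : IsMarkov Q) (E F : Set Ω) (N : ℕ) :
    ∀ ω, ∑ n ∈ Finset.range N, firstHit Q E F n ω ≤ 1 := by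
  have key : ∀ N ω, ∑ n ∈ Finset.range (N + 1), firstHit Q E F n ω ≤ 1 := by
    intro N
    induction N with
    | zero => intro ω; simpa [firstHit] using ind_le_one _ ω
    | succ N ih =>
      intro ω
      rw [sum_firstHit_succ]
      split_ifs
      · exact ind_le_one _ _
      · exact hQ.le_one (fun ω' => by rw [Finset.sum_apply]; exact ih ω') ω
  intro ω
  cases N with
  | zero => simp
  | succ N => exact key N ω

lemma hitBy_nonneg (hQ : IsMarkov Q) (E : Set Ω) (N : ℕ) : 0 ≤ hitBy Q E N := by
  intro ω
  rw [← sum_firstHit_univ]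
  exact Finset.sum_nonneg fun n _ => firstHit_nonneg hQ _ _ n ω

lemma hitBy_sub_le_sum (hQ : IsMarkov Q) (E F : Set Ω) (N : ℕ) :
    ∀ ω, hitBy Q E N ω - hitBy Q (E \ F) N ω
      ≤ ∑ n ∈ Finset.range (N + 1), firstHit Q E F n ω := by
  induction N with
  | zero =>
    intro ω
    by_cases h1 : ω ∈ E <;> by_cases h2 : ω ∈ F <;> simp [firstHit, hitBy, ind, h1, h2]
  | succ N ih =>
    intro ω
    rw [sum_firstHit_succ]
    by_cases h1 : ω ∈ E
    · by_cases h2 : ω ∈ F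
      · have := hQ.nonneg (hitBy_nonneg hQ (E \ F) N) ω
        simp only [hitBy, ind, h1, h2, if_true, Set.mem_sdiff, not_true_eq_false, and_false,
          if_false]
        simp only [Pi.zero_apply] at this
        linarith
      · simp [hitBy, ind, h1, h2]
    · have h3 := hQ.mono (hitBy Q E N - hitBy Q (E \ F) N)
        (∑ n ∈ Finset.range (N + 1), firstHit Q E F n)
        (fun ω' => by rw [Finset.sum_apply]; exact ih ω') ω
      rw [map_sub] at h3
      simpa [hitBy, h1] using h3

lemma pow_ind_le_hitBy (hQ : IsMarkov Q) (E : Set Ω) (N : ℕ) :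
    ∀ ω, (Q ^ N) (ind E) ω ≤ hitBy Q E N ω := by
  induction N with
  | zero => intro ω; exact le_rfl
  | succ N ih =>
    intro ω
    simp only [hitBy]
    split_ifs
    · exact (hQ.pow _).ind_le_one _ _
    · rw [pow_succ', Module.End.mul_apply]
      exact hQ.mono _ _ ih ω

lemma hitBy_le_of_invariant (hQ : IsMarkov Q) {E I : Set Ω} {q : ℝ} (hq : 0 ≤ q)
    (hI : ∀ ω ∈ I, Q (ind Iᶜ) ω ≤ q) (hEI : ∀ ω ∈ I, ω ∉ E) (N : ℕ) :
    ∀ ω ∈ I, hitBy Q E N ω ≤ N * q := by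
  have hle : ∀ N ω, hitBy Q E N ω ≤ 1 := fun N ω => by
    rw [← sum_firstHit_univ]; exact sum_firstHit_le_one hQ _ _ _ _
  induction N with
  | zero => intro ω hω; simp [hitBy, ind, hEI ω hω]
  | succ N ih =>
    intro ω hω
    simp only [hitBy, hEI ω hω, if_false]
    have := hQ.le_const_add (f := hitBy Q E N) (g := ind Iᶜ) (a := N * q) (fun ω' => by
      by_cases h' : ω' ∈ I
      · simpa [ind, h'] using ih ω' h'
      · have h1 := hle N ω'
        have h2 : 0 ≤ (N : ℝ) * q := by positivity
        simp only [ind, Set.mem_compl_iff, h', not_false_eq_true, if_true]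
        linarith) ω
    have h2 := hI ω hω
    push_cast
    linarith

/-- A nearly absorbing set is hit essentially only if it is occupied at the final time. -/
lemma hitBy_le_of_absorbing (hQ : IsMarkov Q) {E : Set Ω} {q : ℝ}
    (hE : ∀ ω ∈ E, Q (ind Eᶜ) ω ≤ q) (hq : 0 ≤ q) (N : ℕ) :
    ∀ ω, hitBy Q E N ω ≤ (Q ^ N) (ind E) ω + N * q := by
  induction N with
  | zero => intro ω; simp [hitBy]
  | succ N ih =>
    intro ω
    by_cases hω : ω ∈ E
    · have h1 := hQ.stay (I := fun _ => E) (q := q) (fun _ => hE) (N + 1) 0 ω hω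
      rw [(hQ.pow _).apply_compl] at h1
      simp only [hitBy, hω, if_true]
      push_cast at h1 ⊢
      linarith
    · simp only [hitBy, hω, if_false]
      have := hQ.le_const_add (f := hitBy Q E N) (g := (Q ^ N) (ind E)) (a := N * q)
        (fun ω' => by linarith [ih ω']) ω
      rw [pow_succ', Module.End.mul_apply]
      push_cast
      linarith

end Hitting

end MarkovOperators

section TransitionOperator

variable {L : ℕ} {β h : ℝ}

lemma flipP_pos (β h : ℝ) (σ : Config L) (x : Site L) (a : Bool) : 0 < flipP β h σ x a := by
  unfold flipP; positivity

lemma flipP_add (β h : ℝ) (σ : Config L) (x : Site L) :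
    flipP β h σ x true + flipP β h σ x false = 1 := by
  unfold flipP spin
  have h1 : Real.exp (-2 * β * (if false = true then 1 else -1) * (nnS σ x + h))
      = (Real.exp (-2 * β * (if true = true then 1 else -1) * (nnS σ x + h)))⁻¹ := by
    rw [← Real.exp_neg]; congr 1; simp
  rw [h1]
  set E := Real.exp (-2 * β * (if true = true then 1 else -1) * (nnS σ x + h))
  have hE : 0 < E := Real.exp_pos _
  field_simp
  ring

variable [NeZero L]

lemma sum_prod_config (w : Site L → Bool → ℝ) :
    ∑ η : Config L, ∏ x, w x (η x) = ∏ x, (w x true + w x false) := by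
  have := (Finset.prod_univ_sum (fun _ : Site L => (Finset.univ : Finset Bool)) w).symm
  rw [Fintype.piFinset_univ] at this
  rw [this]
  exact Finset.prod_congr rfl fun x _ => by simp

/-- The transition operator `f ↦ P f` of the PCA. -/
noncomputable def avgOp (L : ℕ) [NeZero L] (β h : ℝ) : Module.End ℝ (Config L → ℝ) where
  toFun f := fun σ => ∑ η, Pmat β h σ η * f η
  map_add' f g := by funext σ; simp [mul_add, Finset.sum_add_distrib]
  map_smul' c f := by
    funext σ
    simp only [Pi.smul_apply, smul_eq_mul, RingHom.id_apply, Finset.mul_sum]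
    exact Finset.sum_congr rfl fun η _ => by ring

lemma avgOp_apply (f : Config L → ℝ) (σ : Config L) :
    avgOp L β h f σ = ∑ η, Pmat β h σ η * f η := rfl

lemma Pmat_nonneg (σ η : Config L) : 0 ≤ Pmat β h σ η :=
  Finset.prod_nonneg fun x _ => (flipP_pos β h σ x _).le

lemma isMarkov_avgOp (L : ℕ) [NeZero L] (β h : ℝ) : IsMarkov (avgOp L β h) where
  mono f g hfg σ := Finset.sum_le_sum fun η _ =>
    mul_le_mul_of_nonneg_left (hfg η) (Pmat_nonneg σ η)
  map_one := by
    funext σ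
    simp only [avgOp_apply, Pi.one_apply, mul_one, Pmat]
    rw [sum_prod_config (fun x a => flipP β h σ x a)]
    exact Finset.prod_eq_one fun x _ => flipP_add β h σ x

lemma avgOp_ind_cylinder (σ v : Config L) (D : Set (Site L)) :
    avgOp L β h (ind {η : Config L | ∀ x ∈ D, η x = v x}) σ
      = ∏ x, if x ∈ D then flipP β h σ x (v x) else 1 := by
  rw [avgOp_apply]
  have key : ∀ η : Config L, Pmat β h σ η * ind {η : Config L | ∀ x ∈ D, η x = v x} η
      = ∏ x, (flipP β h σ x (η x) * if x ∈ D ∧ η x ≠ v x then 0 else 1) := by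
    intro η
    rw [Finset.prod_mul_distrib, Pmat]
    congr 1
    by_cases hη : ∀ x ∈ D, η x = v x
    · rw [Finset.prod_eq_one]
      · simp [ind]; exact fun a b hab => hη _ hab
      · intro x _
        rw [if_neg]; rintro ⟨h1, h2⟩; exact h2 (hη x h1)
    · push Not at hη
      obtain ⟨x, hx, hne⟩ := hη
      rw [Finset.prod_eq_zero (Finset.mem_univ x) (by simp [hx, hne])]
      simp only [ind, Set.mem_ofPred_eq]
      rw [if_neg]; intro hall; exact hne (hall x hx)
  rw [Finset.sum_congr rfl fun η _ => key η,
    sum_prod_config (fun x a => flipP β h σ x a * if x ∈ D ∧ a ≠ v x then 0 else 1)]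
  refine Finset.prod_congr rfl fun x _ => ?_
  by_cases hx : x ∈ D
  · cases hv : v x <;> simp [hx]
  · simpa [hx] using flipP_add β h σ x

/-- Probability that a deterministic pattern is violated in one step. -/
lemma avgOp_ind_cylinder_compl_le {σ v : Config L} {D : Set (Site L)} {q : ℝ} (hq : 0 ≤ q)
    (hD : ∀ x ∈ D, flipP β h σ x (!(v x)) ≤ q) :
    avgOp L β h (ind {η : Config L | ∀ x ∈ D, η x = v x}ᶜ) σ ≤ Fintype.card (Site L) * q := by
  have hM := isMarkov_avgOp L β h
  have h1 : ind {η : Config L | ∀ x ∈ D, η x = v x}ᶜ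
      ≤ ∑ x, if x ∈ D then ind {η : Config L | ∀ y ∈ ({x} : Set (Site L)), η y = !(v y)}
        else 0 := by
    intro η
    rw [Finset.sum_apply]
    have hnn : ∀ x ∈ (Finset.univ : Finset (Site L)), 0 ≤ (if x ∈ D then
        ind {η : Config L | ∀ y ∈ ({x} : Set (Site L)), η y = !(v y)} else 0) η := by
      intro x _
      split_ifs
      · exact ind_nonneg _ _
      · exact le_rfl
    by_cases hη : ∀ x ∈ D, η x = v x
    · have : ind {η : Config L | ∀ x ∈ D, η x = v x}ᶜ η = 0 := by
        simp only [ind, Set.mem_compl_iff, Set.mem_ofPred_eq]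
        rw [if_neg]; exact not_not.mpr hη
      rw [this]
      exact Finset.sum_nonneg hnn
    · push Not at hη
      obtain ⟨x, hx, hne⟩ := hη
      refine (ind_le_one _ _).trans (le_trans ?_ (Finset.single_le_sum hnn (Finset.mem_univ x)))
      have : η x = !(v x) := by revert hne; cases η x <;> cases v x <;> simp
      simp [hx, ind, this]
  refine (hM.mono _ _ h1 σ).trans ?_
  rw [map_sum, Finset.sum_apply]
  have h2 : ∀ x ∈ (Finset.univ : Finset (Site L)), (avgOp L β h) (if x ∈ D then
      ind {η : Config L | ∀ y ∈ ({x} : Set (Site L)), η y = !(v y)} else 0) σ ≤ q := by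
    intro x _
    split_ifs with hx
    · rw [avgOp_ind_cylinder σ (fun y => !(v y)) {x}]
      simpa using hD x hx
    · simpa using hq
  refine (Finset.sum_le_card_nsmul _ _ _ h2).trans ?_
  simp

lemma firstHitP_eq (E F : Set (Config L)) (n : ℕ) :
    ∀ σ, firstHitP β h σ E F n = firstHit (avgOp L β h) E F n σ := by
  induction n with
  | zero =>
    intro σ
    unfold firstHitP
    rw [← (Equiv.funUnique (Fin 1) (Config L)).symm.sum_comp]
    simp only [firstHit, ind]
    rw [Finset.sum_eq_single σ]
    · simp
    · intro τ _ hne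
      rw [if_neg]; simp [hne]
    · simp
  | succ n ih =>
    intro σ
    unfold firstHitP
    rw [← (Fin.consEquiv (fun _ : Fin (n + 2) => Config L)).sum_comp, Fintype.sum_prod_type,
      Finset.sum_eq_single σ]
    · by_cases hσ : σ ∈ E
      · simp only [firstHit, hσ, if_true]
        refine Finset.sum_eq_zero fun g _ => ?_
        rw [if_neg]
        rintro ⟨-, h2, -⟩
        exact h2 0 (by simp) (by simpa [Fin.consEquiv] using hσ)
      · simp only [firstHit, hσ, if_false, avgOp_apply]
        have hrw : ∀ η, firstHit (avgOp L β h) E F n η = firstHitP β h η E F n :=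
          fun η => (ih η).symm
        simp only [hrw, firstHitP]
        simp only [Finset.mul_sum]
        rw [Finset.sum_comm]
        refine Finset.sum_congr rfl fun g _ => ?_
        rw [Finset.sum_eq_single (g 0)]
        · have hiff : (Fin.consEquiv (fun _ : Fin (n + 2) => Config L) (σ, g) 0 = σ ∧
              (∀ i : Fin (n + 1 + 1), (i : ℕ) < n + 1 →
                Fin.consEquiv (fun _ : Fin (n + 2) => Config L) (σ, g) i ∉ E) ∧
              Fin.consEquiv (fun _ : Fin (n + 2) => Config L) (σ, g) (Fin.last (n + 1)) ∈ E ∩ F) ↔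
              (g 0 = g 0 ∧ (∀ i : Fin (n + 1), (i : ℕ) < n → g i ∉ E) ∧
                g (Fin.last n) ∈ E ∩ F) := by
            simp only [Fin.consEquiv, Equiv.coe_fn_mk, Fin.cons_zero, true_and, Fin.forall_fin_succ (n := n + 1), Fin.cons_succ, ← Fin.succ_last]
            simp [hσ]
          rw [if_congr hiff rfl rfl]
          split_ifs
          · rw [Fin.prod_univ_succ]
            simp [Fin.consEquiv]
          · simp
        · intro η _ hne
          rw [if_neg (fun hh => hne hh.1.symm), mul_zero]
        · simp
    · intro τ _ hne
      refine Finset.sum_eq_zero fun g _ => ?_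
      rw [if_neg]
      rintro ⟨h1, -⟩
      exact hne (by simpa [Fin.consEquiv] using h1)
    · simp

lemma tsum_le_one_of_sum_range_le {u : ℕ → ℝ} (hu : ∀ n, 0 ≤ u n)
    (h1 : ∀ N, ∑ n ∈ Finset.range N, u n ≤ 1) :
    ∑' n, u n ≤ 1 ∧ ∀ s : Finset ℕ, ∑ n ∈ s, u n ≤ ∑' n, u n :=
  have hs : Summable u := summable_of_sum_range_le hu h1
  ⟨hs.tsum_le_of_sum_range_le h1, fun s => hs.sum_le_tsum s fun n _ => hu n⟩

lemma probHitBefore_le_one (σ : Config L) (A B : Set (Config L)) :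
    probHitBefore β h σ A B ≤ 1 := by
  unfold probHitBefore
  simp only [firstHitP_eq]
  exact (tsum_le_one_of_sum_range_le
    (fun n => firstHit_nonneg (isMarkov_avgOp L β h) _ _ n σ)
    (fun N => sum_firstHit_le_one (isMarkov_avgOp L β h) _ _ N σ)).1

lemma le_probHitBefore (σ : Config L) (A B : Set (Config L)) (N : ℕ) :
    hitBy (avgOp L β h) (A ∪ B) N σ - hitBy (avgOp L β h) ((A ∪ B) \ (A \ B)) N σ
      ≤ probHitBefore β h σ A B := by
  unfold probHitBefore
  simp only [firstHitP_eq]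
  exact (hitBy_sub_le_sum (isMarkov_avgOp L β h) _ _ N σ).trans
    ((tsum_le_one_of_sum_range_le
      (fun n => firstHit_nonneg (isMarkov_avgOp L β h) _ _ n σ)
      (fun N => sum_firstHit_le_one (isMarkov_avgOp L β h) _ _ N σ)).2 _)

lemma sum_ite_firstHit_le_one (σ : Config L) (D : Set (Config L)) (I : Set ℝ) (N : ℕ) :
    ∑ n ∈ Finset.range N, (if (n : ℝ) ∈ I then firstHit (avgOp L β h) D Set.univ n σ else 0)
      ≤ 1 := by
  refine le_trans (Finset.sum_le_sum fun n _ => ?_)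
    (sum_firstHit_le_one (isMarkov_avgOp L β h) D Set.univ N σ)
  split_ifs
  · exact le_rfl
  · exact firstHit_nonneg (isMarkov_avgOp L β h) _ _ n σ

lemma ite_firstHit_nonneg (σ : Config L) (D : Set (Config L)) (I : Set ℝ) (n : ℕ) :
    0 ≤ if (n : ℝ) ∈ I then firstHit (avgOp L β h) D Set.univ n σ else 0 := by
  split_ifs
  · exact firstHit_nonneg (isMarkov_avgOp L β h) _ _ n σ
  · exact le_rfl

lemma probTauIn_le_one (σ : Config L) (D : Set (Config L)) (I : Set ℝ) :
    probTauIn β h σ D I ≤ 1 := by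
  unfold probTauIn
  simp only [firstHitP_eq]
  exact (tsum_le_one_of_sum_range_le (ite_firstHit_nonneg σ D I)
    (sum_ite_firstHit_le_one σ D I)).1

lemma le_probTauIn (σ : Config L) (D : Set (Config L)) {I : Set ℝ} {m N : ℕ}
    (hI : ∀ n : ℕ, m < n → n ≤ N → (n : ℝ) ∈ I) :
    hitBy (avgOp L β h) D N σ - hitBy (avgOp L β h) D m σ ≤ probTauIn β h σ D I := by
  unfold probTauIn
  simp only [firstHitP_eq]
  refine le_trans ?_ ((tsum_le_one_of_sum_range_le (ite_firstHit_nonneg σ D I)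
    (sum_ite_firstHit_le_one σ D I)).2 (Finset.range (N + 1)))
  rw [← sum_firstHit_univ, ← sum_firstHit_univ, sub_le_iff_le_add']
  have hnn := fun n => firstHit_nonneg (isMarkov_avgOp L β h) D Set.univ n σ
  have h1 : ∑ n ∈ Finset.range (N + 1), firstHit (avgOp L β h) D Set.univ n σ
      ≤ ∑ n ∈ Finset.range (N + 1),
          ((if n ∈ Finset.range (m + 1) then firstHit (avgOp L β h) D Set.univ n σ else 0)
          + if (n : ℝ) ∈ I then firstHit (avgOp L β h) D Set.univ n σ else 0) := by
    refine Finset.sum_le_sum fun n hn => ?_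
    have h0 := hnn n
    simp only [Pi.zero_apply] at h0
    by_cases hns : n < m + 1
    · simp only [Finset.mem_range, hns, if_true]
      split_ifs <;> linarith
    · have hn2 : n ≤ N := by simpa [Nat.lt_succ_iff] using hn
      simp [hns, hI n (by omega) hn2]
  rw [Finset.sum_add_distrib] at h1
  refine h1.trans (add_le_add ?_ le_rfl)
  rw [← Finset.sum_filter]
  exact Finset.sum_le_sum_of_subset_of_nonneg
    (fun n hn => (Finset.mem_filter.mp hn).2) (fun n _ _ => hnn n)

lemma le_probTauIn_Ioo (σ : Config L) (D : Set (Config L)) {s t : ℝ} {N : ℕ}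
    (hN : (N : ℝ) < t) :
    hitBy (avgOp L β h) D N σ - hitBy (avgOp L β h) D ⌊s⌋₊ σ
      ≤ probTauIn β h σ D (Set.Ioo s t) :=
  le_probTauIn σ D fun n hm hn => ⟨(Nat.lt_of_floor_lt hm), lt_of_le_of_lt (by exact_mod_cast hn) hN⟩

end TransitionOperator

section Sublattices

variable {L : ℕ} {β h : ℝ}

/-- The parity of a site. -/
def par (x : Site L) : ZMod 2 := ((x.1 + x.2).val : ZMod 2)

/-- The sublattice of sites of parity `e`. -/
def subl (L : ℕ) (e : ZMod 2) : Set (Site L) := {x | par x = e}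

/-- The configuration with plus spins exactly on `S`. -/
noncomputable def cfg (S : Set (Site L)) : Config L := fun x => decide (x ∈ S)

/-- All spins of parity `e` inside `S` are plus. -/
def Lo (e : ZMod 2) (S : Set (Site L)) : Set (Config L) :=
  {σ | ∀ x ∈ subl L e ∩ S, σ x = (fun _ => true) x}

/-- All spins of parity `e` outside `S` are minus. -/
def Hi (e : ZMod 2) (S : Set (Site L)) : Set (Config L) :=
  {σ | ∀ x ∈ subl L e \ S, σ x = (fun _ => false) x}

lemma spin_mono {a b : Bool} (hab : a ≤ b) : spin a ≤ spin b := by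
  cases a <;> cases b
  · exact le_rfl
  · norm_num [spin]
  · exact absurd hab (by decide)
  · exact le_rfl

lemma nnS_mono_of {σ τ : Config L} {x : Site L}
    (h1 : σ (x + east L) ≤ τ (x + east L)) (h2 : σ (x - east L) ≤ τ (x - east L))
    (h3 : σ (x + north L) ≤ τ (x + north L)) (h4 : σ (x - north L) ≤ τ (x - north L)) :
    nnS σ x ≤ nnS τ x := by
  unfold nnS
  have := spin_mono h1
  have := spin_mono h2
  have := spin_mono h3
  have := spin_mono h4
  linarith

lemma flipP_le (hβ : 0 ≤ β) {σ : Config L} {x : Site L} {a : Bool} {t : ℝ}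
    (ht : spin a * (nnS σ x + h) ≤ -t) : flipP β h σ x a ≤ Real.exp (-2 * β * t) := by
  unfold flipP
  rw [div_le_iff₀ (by positivity)]
  have h1 : Real.exp (-2 * β * t) * Real.exp (-2 * β * spin a * (nnS σ x + h)) ≥ 1 := by
    rw [← Real.exp_add]
    apply Real.one_le_exp
    nlinarith
  nlinarith [Real.exp_pos (-2 * β * t)]

lemma le_flipP (hβ : 0 ≤ β) {σ : Config L} {x : Site L} {a : Bool} {t : ℝ} (ht0 : 0 ≤ t)
    (ht : -t ≤ spin a * (nnS σ x + h)) : 1 / 2 * Real.exp (-2 * β * t) ≤ flipP β h σ x a := by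
  unfold flipP
  rw [le_div_iff₀ (by positivity)]
  have h1 : Real.exp (-2 * β * t) * Real.exp (-2 * β * spin a * (nnS σ x + h)) ≤ 1 := by
    rw [← Real.exp_add]
    apply Real.exp_le_one_iff.mpr
    nlinarith
  have h2 : Real.exp (-2 * β * t) ≤ 1 := Real.exp_le_one_iff.mpr (by nlinarith)
  nlinarith

lemma half_le_flipP (hβ : 0 ≤ β) {σ : Config L} {x : Site L} {a : Bool}
    (ht : 0 ≤ spin a * (nnS σ x + h)) : 1 / 2 ≤ flipP β h σ x a := by
  simpa using le_flipP (t := 0) hβ le_rfl (by simpa using ht)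

lemma nnS_cfg_empty (x : Site L) : nnS (cfg ∅) x = -4 := by
  simp [nnS, cfg, spin]; norm_num

variable [NeZero L]

lemma par_eq (hL : 2 ∣ L) (x : Site L) : par x = ZMod.castHom hL (ZMod 2) (x.1 + x.2) := by
  simp [par]

lemma par_add_east (hL : 2 ∣ L) (x : Site L) : par (x + east L) = par x + 1 := by
  rw [par_eq hL, par_eq hL]
  simp only [east, Prod.fst_add, Prod.snd_add, map_add, map_one, map_zero]
  ring

lemma par_add_north (hL : 2 ∣ L) (x : Site L) : par (x + north L) = par x + 1 := by
  rw [par_eq hL, par_eq hL]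
  simp only [north, Prod.fst_add, Prod.snd_add, map_add, map_one, map_zero]
  ring

lemma two_zmod_two (a b : ZMod 2) (hab : a = b + 1) : b = a + 1 := by
  subst hab; revert b; decide

lemma par_sub_east (hL : 2 ∣ L) (x : Site L) : par (x - east L) = par x + 1 :=
  two_zmod_two _ _ (by rw [← par_add_east hL, sub_add_cancel])

lemma par_sub_north (hL : 2 ∣ L) (x : Site L) : par (x - north L) = par x + 1 :=
  two_zmod_two _ _ (by rw [← par_add_north hL, sub_add_cancel])

/-- `nnS` at a site only involves the sublattice of opposite parity. -/
lemma nnS_mono_subl (hL : 2 ∣ L) {e : ZMod 2} {σ τ : Config L}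
    (hle : ∀ y ∈ subl L e, σ y ≤ τ y) {x : Site L} (hx : x ∈ subl L (e + 1)) :
    nnS σ x ≤ nnS τ x := by
  have hp : par x + 1 = e := (two_zmod_two _ _ hx).symm
  apply nnS_mono_of <;> apply hle <;> change par _ = e
  · rw [par_add_east hL, hp]
  · rw [par_sub_east hL, hp]
  · rw [par_add_north hL, hp]
  · rw [par_sub_north hL, hp]

lemma nnS_cfg_le_of_Lo (hL : 2 ∣ L) {e : ZMod 2} {S : Set (Site L)} {σ : Config L}
    (hσ : σ ∈ Lo e S) {x : Site L} (hx : x ∈ subl L (e + 1)) : nnS (cfg S) x ≤ nnS σ x := by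
  refine nnS_mono_subl hL (fun y hy => ?_) hx
  by_cases hyS : y ∈ S
  · rw [hσ y ⟨hy, hyS⟩]; exact Bool.le_true _
  · simp [cfg, hyS]

lemma le_nnS_cfg_of_Hi (hL : 2 ∣ L) {e : ZMod 2} {S : Set (Site L)} {σ : Config L}
    (hσ : σ ∈ Hi e S) {x : Site L} (hx : x ∈ subl L (e + 1)) : nnS σ x ≤ nnS (cfg S) x := by
  refine nnS_mono_subl hL (fun y hy => ?_) hx
  by_cases hyS : y ∈ S
  · simp [cfg, hyS, Bool.le_true]
  · rw [hσ y ⟨hy, hyS⟩]; exact Bool.false_le _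

/-- Lower bound on a pattern probability with at most one costly site. -/
lemma le_avgOp_ind_cylinder {σ v : Config L} {D : Set (Site L)} {q : ℝ} (hq : 0 ≤ q)
    (x₀ : Site L) (hD : ∀ x ∈ D, x ≠ x₀ → 1 / 2 ≤ flipP β h σ x (v x))
    (hx₀ : x₀ ∈ D → 1 / 2 * q ≤ flipP β h σ x₀ (v x₀)) (hq1 : q ≤ 1) :
    (1 / 2) ^ Fintype.card (Site L) * q
      ≤ avgOp L β h (ind {η : Config L | ∀ x ∈ D, η x = v x}) σ := by
  rw [avgOp_ind_cylinder]
  have h1 : (1 / 2 : ℝ) ^ Fintype.card (Site L) * q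
      = ∏ x : Site L, (1 / 2 * if x = x₀ then q else 1) := by
    rw [Finset.prod_mul_distrib, Finset.prod_ite_eq']
    simp
  rw [h1]
  refine Finset.prod_le_prod (fun x _ => by split_ifs <;> positivity) fun x _ => ?_
  by_cases hx : x ∈ D
  · by_cases hxx : x = x₀
    · subst hxx; simpa [hx] using hx₀ hx
    · simpa [hx, hxx] using hD x hx hxx
  · rw [if_neg hx]; split_ifs <;> linarith

/-- One step of growth of a plus region. -/
lemma Lo_step (hL : 2 ∣ L) (hβ : 0 ≤ β) (h0 : 0 < h) {t : ℝ} (ht : 0 ≤ t) {e : ZMod 2}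
    {S S' : Set (Site L)} (x₀ : Site L)
    (hS : ∀ x ∈ subl L (e + 1), x ∈ S' → x ≠ x₀ → 0 ≤ nnS (cfg S) x)
    (hx₀ : x₀ ∈ subl L (e + 1) → x₀ ∈ S' → -t ≤ nnS (cfg S) x₀ + h)
    {σ : Config L} (hσ : σ ∈ Lo e S) :
    (1 / 2) ^ Fintype.card (Site L) * Real.exp (-2 * β * t)
      ≤ avgOp L β h (ind (Lo (e + 1) S')) σ := by
  refine le_avgOp_ind_cylinder (Real.exp_pos _).le x₀ (fun x hx hne => ?_) (fun hx => ?_)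
    (Real.exp_le_one_iff.mpr (by nlinarith))
  · apply half_le_flipP hβ
    have := hS x hx.1 hx.2 hne
    have := nnS_cfg_le_of_Lo hL hσ hx.1
    simp only [spin, if_true]; linarith
  · apply le_flipP hβ ht
    have := hx₀ hx.1 hx.2
    have := nnS_cfg_le_of_Lo hL hσ hx.1
    simp only [spin, if_true]; linarith

/-- One step of shrinking of a plus region. -/
lemma Hi_step (hL : 2 ∣ L) (hβ : 0 ≤ β) (h2 : h < 2) {t : ℝ} (ht : 0 ≤ t) {e : ZMod 2}
    {S S' : Set (Site L)} (x₀ : Site L)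
    (hS : ∀ x ∈ subl L (e + 1), x ∉ S' → x ≠ x₀ → nnS (cfg S) x ≤ -2)
    (hx₀ : x₀ ∈ subl L (e + 1) → x₀ ∉ S' → nnS (cfg S) x₀ + h ≤ t)
    {σ : Config L} (hσ : σ ∈ Hi e S) :
    (1 / 2) ^ Fintype.card (Site L) * Real.exp (-2 * β * t)
      ≤ avgOp L β h (ind (Hi (e + 1) S')) σ := by
  refine le_avgOp_ind_cylinder (Real.exp_pos _).le x₀ (fun x hx hne => ?_) (fun hx => ?_)
    (Real.exp_le_one_iff.mpr (by nlinarith))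
  · apply half_le_flipP hβ
    have := hS x hx.1 hx.2 hne
    have := le_nnS_cfg_of_Hi hL hσ hx.1
    simp [spin]; linarith
  · apply le_flipP hβ ht
    have := hx₀ hx.1 hx.2
    have := le_nnS_cfg_of_Hi hL hσ hx.1
    simp [spin]; linarith

lemma Hi_compl_le (hL : 2 ∣ L) (hβ : 0 ≤ β) {t : ℝ} {e : ZMod 2} {S : Set (Site L)}
    (hS : ∀ x ∉ S, nnS (cfg S) x + h ≤ -t) {σ : Config L} (hσ : σ ∈ Hi e S) :
    avgOp L β h (ind (Hi (e + 1) S)ᶜ) σ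
      ≤ Fintype.card (Site L) * Real.exp (-2 * β * t) := by
  refine avgOp_ind_cylinder_compl_le (Real.exp_pos _).le fun x hx => flipP_le hβ ?_
  have := hS x hx.2
  have := le_nnS_cfg_of_Hi hL hσ hx.1
  simp [spin]; linarith

lemma minusC_compl_le (hβ : 0 ≤ β) :
    avgOp L β h (ind {minusC L}ᶜ) (minusC L)
      ≤ Fintype.card (Site L) * Real.exp (-2 * β * (4 - h)) := by
  have h1 : ({minusC L} : Set (Config L)) = {η | ∀ x ∈ Set.univ, η x = minusC L x} := by
    ext η; simp [funext_iff]
  rw [h1]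
  refine avgOp_ind_cylinder_compl_le (Real.exp_pos _).le fun x _ => flipP_le hβ ?_
  simp [spin, nnS, minusC]; linarith

end Sublattices

section Coordinates

variable {L : ℕ}

/-- Cyclic successor of a coordinate. -/
def cycSucc (L i : ℕ) : ℕ := if i + 1 = L then 0 else i + 1

/-- Cyclic predecessor of a coordinate. -/
def cycPred (L i : ℕ) : ℕ := if i = 0 then L - 1 else i - 1

/-- Number of neighbours of the point `(i, j)` satisfying `P`. -/
noncomputable def nbrCount (L : ℕ) (P : ℕ → ℕ → Prop) (i j : ℕ) : ℕ :=
  (if P (cycSucc L i) j then 1 else 0) + (if P (cycPred L i) j then 1 else 0) +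
    (if P i (cycSucc L j) then 1 else 0) + (if P i (cycPred L j) then 1 else 0)

/-- `U` and `V` are integer coordinates on the torus, compatible with neighbours and parities. -/
structure IsCoord (U V : Site L → ℕ) (p : ZMod 2) : Prop where
  lt_left : ∀ x, U x < L
  lt_right : ∀ x, V x < L
  inj : ∀ x y, U x = U y → V x = V y → x = y
  surj : ∀ i j, i < L → j < L → ∃ x, U x = i ∧ V x = j
  par_eq : ∀ x, par x = p + U x + V x
  nnS_eq : ∀ (P : ℕ → ℕ → Prop) (x : Site L),
    nnS (cfg {y | P (U y) (V y)}) x = 2 * (nbrCount L P (U x) (V x) : ℝ) - 4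

lemma spin_decide (p : Prop) : spin (decide p) = 2 * ((if p then 1 else 0 : ℕ) : ℝ) - 1 := by
  by_cases hp : p <;> simp [spin, hp]; norm_num

lemma IsCoord.swap {U V : Site L → ℕ} {p : ZMod 2} (hc : IsCoord U V p) : IsCoord V U p where
  lt_left := hc.lt_right
  lt_right := hc.lt_left
  inj x y h1 h2 := hc.inj x y h2 h1
  surj i j hi hj := by
    obtain ⟨x, h1, h2⟩ := hc.surj j i hj hi
    exact ⟨x, h2, h1⟩
  par_eq x := by rw [hc.par_eq]; ring
  nnS_eq P x := by
    rw [hc.nnS_eq fun i j => P j i]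
    simp only [nbrCount]
    push_cast
    ring

/-- A rectangle in coordinates. -/
def box (U V : Site L → ℕ) (a b : ℕ) : Set (Site L) := {x | U x < a ∧ V x < b}

lemma box_swap (U V : Site L → ℕ) (a b : ℕ) : box V U b a = box U V a b := by
  ext x; exact and_comm

section

variable [NeZero L]

lemma val_add_one_eq (z : ZMod L) : (z + 1).val = cycSucc L z.val := by
  have hz := ZMod.val_lt z
  rw [ZMod.val_add, ZMod.val_one_eq_one_mod, Nat.add_mod_mod]
  unfold cycSucc
  split_ifs with hl
  · rw [hl, Nat.mod_self]
  · exact Nat.mod_eq_of_lt (by omega)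

lemma val_sub_one_eq (z : ZMod L) : (z - 1).val = cycPred L z.val := by
  have h1 := val_add_one_eq (z - 1)
  rw [sub_add_cancel] at h1
  have hz := ZMod.val_lt (z - 1)
  unfold cycSucc at h1
  unfold cycPred
  split_ifs at * <;> omega

lemma isCoord_std (hL : 2 ∣ L) (c : Site L) :
    IsCoord (fun x => (x.1 - c.1).val) (fun x => (x.2 - c.2).val) (par c) where
  lt_left _ := ZMod.val_lt _
  lt_right _ := ZMod.val_lt _
  inj x y h1 h2 := Prod.ext (sub_left_injective (ZMod.val_injective L h1))
    (sub_left_injective (ZMod.val_injective L h2))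
  surj i j hi hj := ⟨(c.1 + i, c.2 + j), by
    simp [ZMod.val_natCast, Nat.mod_eq_of_lt hi], by
    simp [ZMod.val_natCast, Nat.mod_eq_of_lt hj]⟩
  par_eq x := by
    have hv : ∀ z : ZMod L, ((z.val : ℕ) : ZMod 2) = ZMod.castHom hL (ZMod 2) z := by
      intro z; simp
    rw [PCA.par_eq hL, PCA.par_eq hL, hv, hv, ← map_add, ← map_add]
    congr 1
    ring
  nnS_eq P x := by
    simp only [nnS, cfg, Set.mem_ofPred_eq, spin_decide, nbrCount, east, north, Prod.fst_add,
      Prod.snd_add, Prod.fst_sub, Prod.snd_sub, add_zero, sub_zero, add_sub_right_comm,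
      val_add_one_eq, sub_right_comm _ (1 : ZMod L), val_sub_one_eq]
    push_cast
    ring

lemma rect_eq_box (c : Site L) {a b : ℕ} (ha : a ≤ L) (hb : b ≤ L) :
    rect c a b = box (fun x => (x.1 - c.1).val) (fun x => (x.2 - c.2).val) a b := by
  ext x
  constructor
  · rintro ⟨i, j, hi, hj, rfl⟩
    simpa [box, ZMod.val_natCast, Nat.mod_eq_of_lt (hi.trans_le ha),
      Nat.mod_eq_of_lt (hj.trans_le hb)] using ⟨hi, hj⟩
  · rintro ⟨h1, h2⟩
    exact ⟨_, _, h1, h2, by ext <;> simp⟩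

end

/-- The box `a × (b + 1)` without the last `a - j` sites of its top row. -/
def growBox (U V : Site L → ℕ) (a b j : ℕ) : Set (Site L) :=
  {x | U x < a ∧ (V x < b ∨ (U x < j ∧ V x = b))}

/-- The box `a × b` without the first `j` sites of its top row. -/
def peelBox (U V : Site L → ℕ) (a b j : ℕ) : Set (Site L) :=
  {x | U x < a ∧ V x < b ∧ ¬ (U x < j ∧ V x + 1 = b)}

lemma growBox_zero (U V : Site L → ℕ) (a b : ℕ) : growBox U V a b 0 = box U V a b := by
  ext x; simp [growBox, box]

lemma growBox_self (U V : Site L → ℕ) (a b : ℕ) : growBox U V a b a = box U V a (b + 1) := by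
  ext x; simp only [growBox, box, Set.mem_ofPred_eq]; omega

lemma peelBox_zero (U V : Site L → ℕ) (a b : ℕ) : peelBox U V a b 0 = box U V a b := by
  ext x; simp [peelBox, box]

lemma peelBox_self (U V : Site L → ℕ) (a b : ℕ) : peelBox U V a (b + 1) a = box U V a b := by
  ext x; simp only [peelBox, box, Set.mem_ofPred_eq]; omega

variable {U V : Site L → ℕ} {p : ZMod 2}

lemma IsCoord.le_nnS (hc : IsCoord U V p) {P : ℕ → ℕ → Prop} {x : Site L} {n : ℕ}
    (hn : n ≤ nbrCount L P (U x) (V x)) : 2 * (n : ℝ) - 4 ≤ nnS (cfg {y | P (U y) (V y)}) x := by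
  have : (n : ℝ) ≤ nbrCount L P (U x) (V x) := by exact_mod_cast hn
  rw [hc.nnS_eq]; linarith

lemma IsCoord.nnS_le (hc : IsCoord U V p) {P : ℕ → ℕ → Prop} {x : Site L} {n : ℕ}
    (hn : nbrCount L P (U x) (V x) ≤ n) : nnS (cfg {y | P (U y) (V y)}) x ≤ 2 * (n : ℝ) - 4 := by
  have : (nbrCount L P (U x) (V x) : ℝ) ≤ n := by exact_mod_cast hn
  rw [hc.nnS_eq]; linarith

lemma box_nnS_nonneg (hc : IsCoord U V p) {a b : ℕ} (ha : 2 ≤ a) (hb : 2 ≤ b) {x : Site L}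
    (hx : x ∈ box U V a b) : 0 ≤ nnS (cfg (box U V a b)) x := by
  have hu := hc.lt_left x
  have hv := hc.lt_right x
  have h1 := hc.le_nnS (P := fun i j => i < a ∧ j < b) (x := x) (n := 2) (by
    obtain ⟨hx1, hx2⟩ := hx
    generalize U x = i at *
    generalize V x = j at *
    unfold nbrCount cycSucc cycPred
    split_ifs <;> omega)
  norm_num at h1
  exact h1

lemma box_nnS_le (hc : IsCoord U V p) {a b : ℕ} (ha : a + 2 ≤ L) (hb : b + 2 ≤ L) {x : Site L}
    (hx : x ∉ box U V a b) : nnS (cfg (box U V a b)) x ≤ -2 := by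
  have hu := hc.lt_left x
  have hv := hc.lt_right x
  have h1 := hc.nnS_le (P := fun i j => i < a ∧ j < b) (x := x) (n := 1) (by
    have hx2 : ¬ (U x < a ∧ V x < b) := hx
    clear hx
    generalize U x = i at *
    generalize V x = j at *
    unfold nbrCount cycSucc cycPred
    split_ifs <;> omega)
  norm_num at h1
  exact h1

lemma growBox_nnS_nonneg (hc : IsCoord U V p) {a b j : ℕ} (ha : 2 ≤ a) (hb : 2 ≤ b)
    {x : Site L} (hx : x ∈ growBox U V a b (j + 1))
    (hpar : V x = b → U x % 2 = j % 2) (hne : ¬ (j = 0 ∧ U x = 0 ∧ V x = b)) :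
    0 ≤ nnS (cfg (growBox U V a b j)) x := by
  have hu := hc.lt_left x
  have hv := hc.lt_right x
  have h1 := hc.le_nnS (P := fun i k => i < a ∧ (k < b ∨ (i < j ∧ k = b))) (x := x) (n := 2) (by
    have hx2 : U x < a ∧ (V x < b ∨ (U x < j + 1 ∧ V x = b)) := hx
    clear hx
    generalize U x = i at *
    generalize V x = k at *
    unfold nbrCount cycSucc cycPred
    split_ifs <;> omega)
  norm_num at h1
  exact h1

lemma growBox_nnS_corner (hc : IsCoord U V p) {a b : ℕ} (ha : 2 ≤ a) (hb : 2 ≤ b)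
    {x : Site L} (hx : U x = 0 ∧ V x = b) : -2 ≤ nnS (cfg (growBox U V a b 0)) x := by
  have hu := hc.lt_left x
  have hv := hc.lt_right x
  have h1 := hc.le_nnS (P := fun i k => i < a ∧ (k < b ∨ (i < 0 ∧ k = b))) (x := x) (n := 1) (by
    generalize U x = i at *
    generalize V x = k at *
    unfold nbrCount cycSucc cycPred
    split_ifs <;> omega)
  norm_num at h1
  simpa [growBox] using h1

lemma peelBox_nnS_le (hc : IsCoord U V p) {a b j : ℕ} (ha : a + 2 ≤ L) (hb : b + 2 ≤ L)
    {x : Site L} (hx : x ∉ peelBox U V a b (j + 1))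
    (hpar : V x + 1 = b → U x % 2 = j % 2) (hne : ¬ (j + 1 < a ∧ U x = j ∧ V x + 1 = b)) :
    nnS (cfg (peelBox U V a b j)) x ≤ -2 := by
  have hu := hc.lt_left x
  have hv := hc.lt_right x
  have h1 := hc.nnS_le (P := fun i k => i < a ∧ k < b ∧ ¬ (i < j ∧ k + 1 = b))
    (x := x) (n := 1) (by
    have hx2 : ¬ (U x < a ∧ V x < b ∧ ¬ (U x < j + 1 ∧ V x + 1 = b)) := hx
    clear hx
    generalize U x = i at *
    generalize V x = k at *
    unfold nbrCount cycSucc cycPred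
    split_ifs <;> omega)
  norm_num at h1
  simpa [peelBox] using h1

lemma peelBox_nnS_corner (hc : IsCoord U V p) {a b j : ℕ} (ha : a + 2 ≤ L) (hb : b + 2 ≤ L)
    {x : Site L} (hx : U x = j ∧ V x + 1 = b) :
    nnS (cfg (peelBox U V a b j)) x ≤ 0 := by
  have hu := hc.lt_left x
  have hv := hc.lt_right x
  have h1 := hc.nnS_le (P := fun i k => i < a ∧ k < b ∧ ¬ (i < j ∧ k + 1 = b))
    (x := x) (n := 2) (by
    generalize U x = i at *
    generalize V x = k at *
    unfold nbrCount cycSucc cycPred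
    split_ifs <;> omega)
  norm_num at h1
  simpa [peelBox] using h1

end Coordinates

section Passages

/-- `Q ^ n` sends every state of `G` into `G'` with probability at least `w`. -/
def Reach {Ω : Type*} (Q : Module.End ℝ (Ω → ℝ)) (n : ℕ) (w : ℝ) (G G' : Set Ω) : Prop :=
  ∀ ω ∈ G, w ≤ (Q ^ n) (ind G') ω

lemma Reach.trans {Ω : Type*} {Q : Module.End ℝ (Ω → ℝ)} (hQ : IsMarkov Q) {n m k : ℕ}
    {w w' v : ℝ} {G G' G'' : Set Ω} (h1 : Reach Q n w G G') (h2 : Reach Q m w' G' G'')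
    (hw : 0 ≤ w') (hk : k = n + m) (hv : v ≤ w * w') : Reach Q k v G G'' := by
  subst hk
  intro ω hω
  rw [pow_add]
  exact hv.trans ((hQ.pow n).lower_comp hw h1 h2 (hQ.pow m) ω hω)

lemma Reach.one {Ω : Type*} {Q : Module.End ℝ (Ω → ℝ)} {w : ℝ} {G G' : Set Ω}
    (h : ∀ ω ∈ G, w ≤ Q (ind G') ω) : Reach Q 1 w G G' := by
  intro ω hω; rw [pow_one]; exact h ω hω

lemma Reach.refl {Ω : Type*} (Q : Module.End ℝ (Ω → ℝ)) (G : Set Ω) : Reach Q 0 1 G G := by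
  intro ω hω; simp [ind, hω]

variable {L : ℕ} [NeZero L] {β h : ℝ} {U V : Site L → ℕ} {p : ZMod 2}

/-- The crude lower bound for the probability of a typical one-step pattern. -/
noncomputable def stepW (L : ℕ) [NeZero L] : ℝ := (1 / 2) ^ Fintype.card (Site L)

lemma stepW_pos : 0 < stepW L := by unfold stepW; positivity

lemma stepW_le_one : stepW L ≤ 1 := by
  unfold stepW; exact pow_le_one₀ (by norm_num) (by norm_num)

lemma reach_Lo_idle (hL : 2 ∣ L) (hβ : 0 ≤ β) (h0 : 0 < h) (hc : IsCoord U V p) {a b : ℕ}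
    (ha : 2 ≤ a) (hb : 2 ≤ b) (n : ℕ) (e : ZMod 2) :
    Reach (avgOp L β h) n (stepW L ^ n) (Lo e (box U V a b)) (Lo (e + n) (box U V a b)) := by
  induction n with
  | zero => simpa using Reach.refl (avgOp L β h) (Lo e (box U V a b))
  | succ n ih =>
    refine ih.trans (w' := stepW L) (isMarkov_avgOp L β h) (Reach.one fun σ hσ => ?_)
      stepW_pos.le rfl (pow_succ _ _).le
    have h1 := Lo_step (S := box U V a b) (S' := box U V a b) hL hβ h0 (t := 0) le_rfl (0 : Site L)
      (fun x _ hx _ => box_nnS_nonneg hc ha hb hx)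
      (fun _ hx => by have := box_nnS_nonneg hc ha hb hx; linarith) hσ
    simpa [stepW, add_assoc] using h1

lemma reach_Hi_idle (hL : 2 ∣ L) (hβ : 0 ≤ β) (h2 : h < 2) (hc : IsCoord U V p) {a b : ℕ}
    (ha : a + 2 ≤ L) (hb : b + 2 ≤ L) (n : ℕ) (e : ZMod 2) :
    Reach (avgOp L β h) n (stepW L ^ n) (Hi e (box U V a b)) (Hi (e + n) (box U V a b)) := by
  induction n with
  | zero => simpa using Reach.refl (avgOp L β h) (Hi e (box U V a b))
  | succ n ih =>
    refine ih.trans (w' := stepW L) (isMarkov_avgOp L β h) (Reach.one fun σ hσ => ?_)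
      stepW_pos.le rfl (pow_succ _ _).le
    have h1 := Hi_step (S := box U V a b) (S' := box U V a b) hL hβ h2 (t := 0) le_rfl (0 : Site L)
      (fun x _ hx _ => box_nnS_le hc ha hb hx)
      (fun _ hx => by have := box_nnS_le hc ha hb hx; linarith) hσ
    simpa [stepW, add_assoc] using h1

omit [NeZero L] in
lemma IsCoord.parity_iff (hc : IsCoord U V p) {e : ZMod 2} {b j : ℕ} (he : p + b = e)
    {x : Site L} (hx : x ∈ subl L (e + j)) (hV : V x = b) : U x % 2 = j % 2 := by
  have h1 : par x = e + j := hx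
  rw [hc.par_eq, hV, ← he] at h1
  have h3 : ((U x : ℕ) : ZMod 2) = (j : ℕ) := by linear_combination h1
  exact (ZMod.natCast_eq_natCast_iff' _ _ 2).mp h3

lemma reach_grow_aux (hL : 2 ∣ L) (hβ : 0 ≤ β) (h0 : 0 < h) (h2 : h < 2) (hc : IsCoord U V p)
    {a b : ℕ} (ha : 2 ≤ a) (hb : 2 ≤ b) (hbL : b < L) {e : ZMod 2} (he : p + b = e + 1) (j : ℕ) :
    Reach (avgOp L β h) (j + 1) (stepW L ^ (j + 1) * Real.exp (-2 * β * (2 - h)))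
      (Lo e (growBox U V a b 0)) (Lo (e + (j + 1 : ℕ)) (growBox U V a b (j + 1))) := by
  have hLpos : 0 < L := by omega
  induction j with
  | zero =>
    refine Reach.one fun σ hσ => ?_
    obtain ⟨x₀, hx₀⟩ := hc.surj 0 b hLpos hbL
    have h1 := Lo_step (S := growBox U V a b 0) (S' := growBox U V a b 1) hL hβ h0
      (t := 2 - h) (by linarith) x₀
      (fun x hx hxS hne => growBox_nnS_nonneg hc ha hb hxS
        (fun hV => hc.parity_iff he (j := 0) (by simpa using hx) hV)
        (fun hh => hne (hc.inj _ _ (hh.2.1.trans hx₀.1.symm) (hh.2.2.trans hx₀.2.symm))))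
      (fun _ _ => by have := growBox_nnS_corner hc ha hb hx₀; linarith) hσ
    simpa [stepW] using h1
  | succ j ih =>
    refine ih.trans (w' := stepW L) (isMarkov_avgOp L β h) (Reach.one fun σ hσ => ?_)
      stepW_pos.le rfl (by rw [pow_succ _ (j + 1)]; ring_nf; exact le_rfl)
    have hgood : ∀ x ∈ subl L (e + (j + 1 : ℕ) + 1), x ∈ growBox U V a b (j + 1 + 1) →
        0 ≤ nnS (cfg (growBox U V a b (j + 1))) x := fun x hx hxS =>
      growBox_nnS_nonneg hc ha hb hxS
        (fun hV => hc.parity_iff he (j := j + 1) (by convert hx using 2; ring) hV) (by omega)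
    have h1 := Lo_step (S := growBox U V a b (j + 1)) (S' := growBox U V a b (j + 1 + 1)) hL hβ h0
      (t := 0) le_rfl (0 : Site L) (fun x hx hxS _ => hgood x hx hxS)
      (fun hx hxS => by have := hgood _ hx hxS; linarith) hσ
    have h3 : e + ((j + 1 + 1 : ℕ) : ZMod 2) = e + (j + 1 : ℕ) + 1 := by push_cast; ring
    rw [h3]
    simpa [stepW] using h1

lemma natCast_two_mul (e : ZMod 2) (n : ℕ) : e + ((2 * n : ℕ) : ZMod 2) = e := by
  have : ((2 : ℕ) : ZMod 2) = 0 := rfl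
  push_cast at this ⊢
  rw [this]; ring

lemma exists_idle (e r : ZMod 2) : ∃ m : ℕ, m ≤ 1 ∧ r = e + m + 1 := by
  have : ∀ e r : ZMod 2, r = e + (0 : ℕ) + 1 ∨ r = e + (1 : ℕ) + 1 := by decide
  rcases this e r with h | h
  · exact ⟨0, by omega, h⟩
  · exact ⟨1, le_rfl, h⟩

/-- A plus box grows by one row. -/
lemma reach_grow (hL : 2 ∣ L) (hβ : 0 ≤ β) (h0 : 0 < h) (h2 : h < 2) (hc : IsCoord U V p)
    {a b : ℕ} (ha : 2 ≤ a) (haL : a ≤ L) (hb : 2 ≤ b) (hbL : b < L) (e : ZMod 2) :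
    Reach (avgOp L β h) (2 * L) (stepW L ^ (2 * L) * Real.exp (-2 * β * (2 - h)))
      (Lo e (box U V a b)) (Lo e (box U V a (b + 1))) := by
  obtain ⟨m, hm, he⟩ := exists_idle e (p + b)
  obtain ⟨j, rfl⟩ : ∃ j, a = j + 1 := ⟨a - 1, by omega⟩
  have h3 := reach_grow_aux hL hβ h0 h2 hc ha hb hbL he j
  rw [growBox_zero, growBox_self] at h3
  have h4 := reach_Lo_idle hL hβ h0 hc ha hb m e
  have h5 := reach_Lo_idle hL hβ h0 hc ha (show 2 ≤ b + 1 by omega) (2 * L - m - (j + 1))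
    (e + m + (j + 1 : ℕ))
  have h6 : e + m + (j + 1 : ℕ) + ((2 * L - m - (j + 1) : ℕ) : ZMod 2) = e := by
    have h7 : m + (j + 1) + (2 * L - m - (j + 1)) = 2 * L := by omega
    rw [add_assoc, add_assoc, ← Nat.cast_add, ← Nat.cast_add, ← add_assoc, h7, natCast_two_mul]
  rw [h6] at h5
  have hM := isMarkov_avgOp L β h
  have hs := stepW_pos (L := L)
  refine (h4.trans hM h3 (by positivity) rfl le_rfl).trans hM h5 (by positivity) (by omega) ?_
  have h8 : 2 * L = m + (j + 1) + (2 * L - m - (j + 1)) := by omega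
  rw [show stepW L ^ (2 * L) = stepW L ^ m * stepW L ^ (j + 1) *
    stepW L ^ (2 * L - m - (j + 1)) by rw [← pow_add, ← pow_add, ← h8]]
  apply le_of_eq; ring

lemma reach_peel_aux (hL : 2 ∣ L) (hβ : 0 ≤ β) (h0 : 0 < h) (h2 : h < 2) (hc : IsCoord U V p)
    {a b : ℕ} (ha : a + 2 ≤ L) (hb : b + 1 + 2 ≤ L)
    {e : ZMod 2} (he : p + b = e + 1) (j : ℕ) (hj : j < a) :
    Reach (avgOp L β h) j (stepW L ^ j * Real.exp (-2 * β * h) ^ j)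
      (Hi e (peelBox U V a (b + 1) 0)) (Hi (e + j) (peelBox U V a (b + 1) j)) := by
  induction j with
  | zero => simpa using Reach.refl (avgOp L β h) _
  | succ j ih =>
    refine (ih (by omega)).trans (w' := stepW L * Real.exp (-2 * β * h)) (isMarkov_avgOp L β h)
      (Reach.one fun σ hσ => ?_) (mul_pos stepW_pos (Real.exp_pos _)).le rfl
      (by rw [pow_succ, pow_succ]; apply le_of_eq; ring)
    obtain ⟨x₀, hx₀⟩ := hc.surj j b (by omega) (by omega)
    have h1 := Hi_step (S := peelBox U V a (b + 1) j) (S' := peelBox U V a (b + 1) (j + 1))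
      hL hβ h2 (t := h) h0.le x₀
      (fun x hx hxS hne => peelBox_nnS_le hc ha hb hxS
        (fun hV => hc.parity_iff he (j := j) (by convert hx using 2; ring) (by omega))
        (fun hh => hne (hc.inj _ _ (hh.2.1.trans hx₀.1.symm) (by omega))))
      (fun _ _ => by
        have := peelBox_nnS_corner hc (b := b + 1) ha hb (x := x₀) ⟨hx₀.1, by omega⟩
        linarith) hσ
    have h3 : e + ((j + 1 : ℕ) : ZMod 2) = e + j + 1 := by push_cast; ring
    rw [h3]
    simpa [stepW] using h1

/-- A plus box loses one row. -/
lemma reach_peel (hL : 2 ∣ L) (hβ : 0 ≤ β) (h0 : 0 < h) (h2 : h < 2) (hc : IsCoord U V p)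
    {a b : ℕ} (ha1 : 1 ≤ a) (ha : a + 2 ≤ L) (hb : b + 1 + 2 ≤ L) (e : ZMod 2) :
    Reach (avgOp L β h) (2 * L) (stepW L ^ (2 * L) * Real.exp (-2 * β * h) ^ (a - 1))
      (Hi e (box U V a (b + 1))) (Hi e (box U V a b)) := by
  obtain ⟨m, hm, he⟩ := exists_idle e (p + b)
  obtain ⟨j, rfl⟩ : ∃ j, a = j + 1 := ⟨a - 1, by omega⟩
  have hM := isMarkov_avgOp L β h
  have hs := stepW_pos (L := L)
  have h3 := reach_peel_aux hL hβ h0 h2 hc ha hb he j (by omega)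
  have h3b : Reach (avgOp L β h) 1 (stepW L) (Hi (e + m + j) (peelBox U V (j + 1) (b + 1) j))
      (Hi (e + m + (j + 1 : ℕ)) (peelBox U V (j + 1) (b + 1) (j + 1))) := by
    refine Reach.one fun σ hσ => ?_
    have hgood : ∀ x ∈ subl L (e + m + j + 1), x ∉ peelBox U V (j + 1) (b + 1) (j + 1) →
        nnS (cfg (peelBox U V (j + 1) (b + 1) j)) x ≤ -2 := fun x hx hxS =>
      peelBox_nnS_le hc ha hb hxS
        (fun hV => hc.parity_iff he (j := j) (by convert hx using 2; ring) (by omega)) (by omega)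
    have h1 := Hi_step (S := peelBox U V (j + 1) (b + 1) j)
      (S' := peelBox U V (j + 1) (b + 1) (j + 1)) hL hβ h2
      (t := 0) le_rfl (0 : Site L) (fun x hx hxS _ => hgood x hx hxS)
      (fun hx hxS => by have := hgood _ hx hxS; linarith) hσ
    have h5 : e + m + ((j + 1 : ℕ) : ZMod 2) = e + m + j + 1 := by push_cast; ring
    rw [h5]
    simpa [stepW] using h1
  rw [peelBox_zero] at h3
  rw [peelBox_self] at h3b
  have h4 := reach_Hi_idle hL hβ h2 hc ha hb m e
  have h5 := reach_Hi_idle hL hβ h2 hc ha (show b + 2 ≤ L by omega) (2 * L - m - (j + 1))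
    (e + m + (j + 1 : ℕ))
  have h6 : e + m + (j + 1 : ℕ) + ((2 * L - m - (j + 1) : ℕ) : ZMod 2) = e := by
    have h7 : m + (j + 1) + (2 * L - m - (j + 1)) = 2 * L := by omega
    rw [add_assoc, add_assoc, ← Nat.cast_add, ← Nat.cast_add, ← add_assoc, h7, natCast_two_mul]
  rw [h6] at h5
  refine ((h4.trans hM h3 (by positivity) rfl le_rfl).trans hM h3b hs.le rfl le_rfl).trans hM h5
    (by positivity) (by omega) ?_
  have h8 : 2 * L = m + j + 1 + (2 * L - m - (j + 1)) := by omega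
  rw [show stepW L ^ (2 * L) = stepW L ^ m * stepW L ^ j * stepW L *
    stepW L ^ (2 * L - m - (j + 1)) by rw [← pow_add, ← pow_succ, ← pow_add, ← h8]]
  rw [Nat.add_sub_cancel]
  apply le_of_eq; ring

end Passages

section IsingWeight

variable {L : ℕ} [NeZero L] {h : ℝ}

/-- Minus the Ising energy of a configuration. -/
noncomputable def isingW (h : ℝ) (τ : Config L) : ℝ :=
  ∑ x, spin (τ x) * (spin (τ (x + east L)) + spin (τ (x + north L))) + h * ∑ x, spin (τ x)

/-- The bilinear form counting aligned bonds. -/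
noncomputable def bond (f g : Site L → ℝ) : ℝ := ∑ x, f x * (g (x + east L) + g (x + north L))

lemma bond_add_smul (f g : Site L → ℝ) (t : ℝ) :
    bond (f + t • g) (f + t • g) = bond f f + t * bond f g + t * bond g f + t ^ 2 * bond g g := by
  simp only [bond, Finset.mul_sum, ← Finset.sum_add_distrib]
  exact Finset.sum_congr rfl fun x _ => by simp; ring

lemma isingW_update (hL : 2 ≤ L) (τ : Config L) (x : Site L) :
    isingW h (Function.update τ x true) - isingW h (Function.update τ x false)
      = 2 * (nnS τ x + h) := by
  have : Fact (1 < L) := ⟨hL⟩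
  have hone : (1 : ZMod L) ≠ 0 := one_ne_zero
  have hE : east L ≠ 0 := fun hh => hone (congrArg Prod.fst hh)
  have hN : north L ≠ 0 := fun hh => hone (congrArg Prod.snd hh)
  set s : Site L → ℝ := fun y => spin (Function.update τ x false y) with hs
  set d : Site L → ℝ := fun y => if y = x then 1 else 0 with hd
  have h1 : (fun y => spin (Function.update τ x true y)) = s + (2 : ℝ) • d := by
    funext y
    by_cases hy : y = x
    · subst hy; simp [hs, hd, spin]; norm_num
    · simp [hs, hd, hy]
  have hW : ∀ τ : Config L, isingW h τ
      = bond (fun y => spin (τ y)) (fun y => spin (τ y)) + h * ∑ y, spin (τ y) := fun _ => rfl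
  have hsum : Finset.univ.sum (s + (2 : ℝ) • d) = ∑ y, s y + 2 := by
    simp only [Pi.add_apply, Pi.smul_apply, smul_eq_mul, Finset.sum_add_distrib,
      ← Finset.mul_sum]
    simp [hd]
  have hdg : ∀ g : Site L → ℝ, bond d g = g (x + east L) + g (x + north L) := by
    intro g; simp [bond, hd]
  have hgd : ∀ g : Site L → ℝ, bond g d = g (x - east L) + g (x - north L) := by
    intro g
    simp only [bond, hd, mul_add, Finset.sum_add_distrib, ← eq_sub_iff_add_eq]
    simp
  have hdd : bond d d = 0 := by
    rw [hdg]; simp [hd, hE, hN]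
  have hs1 : ∀ y, y ≠ x → s y = spin (τ y) := fun y hy => by simp [hs, hy]
  rw [hW, hW, h1, bond_add_smul, hdd, hdg, hgd, hsum, hs1 _ (by simpa using hE),
    hs1 _ (by simpa using hN), hs1 _ (by simpa using hE), hs1 _ (by simpa using hN), nnS]
  change _ - (bond s s + h * ∑ y, s y) = _
  ring

lemma exists_cyc_step {P : ZMod L → Prop} {i j : ZMod L} (hi : P i) (hj : ¬ P j) :
    ∃ k, P k ∧ ¬ P (k + 1) := by
  by_contra hcon
  push Not at hcon
  have : ∀ n : ℕ, P (i + n) := by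
    intro n
    induction n with
    | zero => simpa using hi
    | succ n ih => have := hcon _ ih; rwa [add_assoc, ← Nat.cast_succ] at this
  have h2 := this (j - i).val
  rw [ZMod.natCast_val, ZMod.cast_id', id, add_sub_cancel] at h2
  exact hj h2

lemma sum_spin_mul_spin (u : ZMod L → Bool) :
    ∑ i, spin (u i) * spin (u (i + 1))
      = Fintype.card (ZMod L) - 2 * ((Finset.univ.filter fun i => u i ≠ u (i + 1)).card : ℝ) := by
  have : ∀ i, spin (u i) * spin (u (i + 1)) = 1 - 2 * (if u i ≠ u (i + 1) then 1 else 0 : ℝ) := by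
    intro i
    cases u i <;> cases u (i + 1) <;> simp [spin] <;> norm_num
  simp only [this, Finset.sum_sub_distrib, ← Finset.mul_sum, Finset.sum_boole]
  simp

/-- A nonempty subset of an arc of a cycle has at least as many boundary bonds as the arc. -/
lemma cyc_bonds_le {c : ZMod L} {a : ℕ} {r u : ZMod L → Bool}
    (hr : ∀ i, r i = decide ((i - c).val < a)) (hu : ∀ i, u i = true → r i = true)
    (hne : ∃ i, u i = true) :
    ∑ i, spin (u i) * spin (u (i + 1)) ≤ ∑ i, spin (r i) * spin (r (i + 1)) := by
  rw [sum_spin_mul_spin, sum_spin_mul_spin]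
  suffices h1 : (Finset.univ.filter fun i => r i ≠ r (i + 1)).card
      ≤ (Finset.univ.filter fun i => u i ≠ u (i + 1)).card by
    have : ((Finset.univ.filter fun i => r i ≠ r (i + 1)).card : ℝ)
      ≤ (Finset.univ.filter fun i => u i ≠ u (i + 1)).card := by exact_mod_cast h1
    linarith
  by_cases hall : ∀ i, r i = true
  · simp [hall]
  push Not at hall
  obtain ⟨j, hj⟩ := hall
  obtain ⟨i, hi⟩ := hne
  have hj2 : u j ≠ true := fun hh => hj (hu j hh)
  obtain ⟨k, hk1, hk2⟩ := exists_cyc_step (P := fun i => u i = true) hi hj2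
  obtain ⟨k', hk1', hk2'⟩ := exists_cyc_step (P := fun i => u i ≠ true) hj2 (by simpa using hi)
  have hkk : k ≠ k' := fun hh => hk1' (hh ▸ hk1)
  have h2 : ({k, k'} : Finset (ZMod L)) ⊆ Finset.univ.filter fun i => u i ≠ u (i + 1) := by
    intro y hy
    rw [Finset.mem_insert, Finset.mem_singleton] at hy
    rw [Finset.mem_filter]
    refine ⟨Finset.mem_univ _, ?_⟩
    rcases hy with rfl | rfl
    · rw [hk1]; exact fun hh => hk2 hh.symm
    · rw [not_not.mp hk2']; exact hk1'
  have h3 : (Finset.univ.filter fun i => r i ≠ r (i + 1)) ⊆ {c - 1, c + (a - 1 : ℕ)} := by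
    intro y hy
    have hy2 := (Finset.mem_filter.mp hy).2
    rw [hr, hr, show y + 1 - c = (y - c) + 1 by ring, val_add_one_eq] at hy2
    have hlt := ZMod.val_lt (y - c)
    rw [Finset.mem_insert, Finset.mem_singleton]
    have hyc : y = c + ((y - c).val : ℕ) := by rw [ZMod.natCast_val, ZMod.cast_id', id]; ring
    by_cases hl : (y - c).val + 1 = L
    · left
      have : ((y - c).val : ZMod L) + 1 = 0 := by
        have := congrArg (fun n : ℕ => (n : ZMod L)) hl
        simpa using this
      rw [ZMod.natCast_val, ZMod.cast_id', id] at this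
      linear_combination this
    · right
      rw [cycSucc, if_neg hl] at hy2
      have : (y - c).val = a - 1 := by
        have : ¬ ((y - c).val < a ↔ (y - c).val + 1 < a) := fun hh => hy2 (by simp [hh])
        omega
      rw [← this]; exact hyc
  calc _ ≤ _ := Finset.card_le_card h3
    _ ≤ 2 := Finset.card_le_two
    _ = ({k, k'} : Finset (ZMod L)).card := (Finset.card_pair hkk).symm
    _ ≤ _ := Finset.card_le_card h2

/-- Number of minus spins inside `R`. -/
noncomputable def holes (R : Set (Site L)) (τ : Config L) : ℕ :=
  (Finset.univ.filter fun x => x ∈ R ∧ τ x = false).card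

lemma le_holes {U V : Site L → ℕ} {p : ZMod 2} (hc : IsCoord U V p) {a b j : ℕ} (ha : a ≤ L)
    (hb : b ≤ L) (hj : j < b) {τ : Config L} (hτ : ∀ x, U x < a → V x = j → τ x = false) :
    a ≤ holes (box U V a b) τ := by
  choose f hf using fun i : Fin a => hc.surj i j (i.2.trans_le ha) (hj.trans_le hb)
  have h1 : (Finset.univ : Finset (Fin a)).card ≤ holes (box U V a b) τ := by
    refine Finset.card_le_card_of_injOn f (fun i _ => ?_) (fun i _ i' _ hii => ?_)
    · rw [Finset.mem_coe, Finset.mem_filter]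
      exact ⟨Finset.mem_univ _, ⟨(hf i).1.trans_lt i.2, (hf i).2.trans_lt hj⟩,
        hτ _ ((hf i).1.trans_lt i.2) (hf i).2⟩
    · apply Fin.ext
      rw [← (hf i).1, ← (hf i').1, hii]
  simpa using h1

/-- Removing few sites from a rectangle does not decrease its perimeter. -/
lemma isingW_le (hL : 2 ∣ L) {c : Site L} {a b : ℕ} (ha : a ≤ L) (hb : b ≤ L) {R : Set (Site L)}
    (hR : R = box (fun x => (x.1 - c.1).val) (fun x => (x.2 - c.2).val) a b) {τ : Config L}
    (hτ : ∀ x ∉ R, τ x = false) (hma : holes R τ < a) (hmb : holes R τ < b) :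
    isingW h τ + 2 * h * holes R τ ≤ isingW h (cfg R) := by
  have hc := isCoord_std hL c
  have hle : ∀ x, τ x = true → cfg R x = true := by
    intro x hx
    by_contra hcon
    have : x ∉ R := by simpa [cfg] using hcon
    rw [hτ x this] at hx; exact absurd hx (by simp)
  have hsum : ∑ x, spin (cfg R x) = ∑ x, spin (τ x) + 2 * holes R τ := by
    have : ∀ x, spin (cfg R x) = spin (τ x) + 2 * (if x ∈ R ∧ τ x = false then 1 else 0 : ℝ) := by
      intro x
      by_cases hx : x ∈ R
      · cases hxx : τ x <;> simp [cfg, hx, spin]; norm_num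
      · simp [cfg, hx, spin, hτ x hx]
    simp only [this, Finset.sum_add_distrib, ← Finset.mul_sum, Finset.sum_boole, holes]
  have hrow : ∀ j : ZMod L, ∑ i : ZMod L, spin (τ (i, j)) * spin (τ (i + 1, j))
      ≤ ∑ i : ZMod L, spin (cfg R (i, j)) * spin (cfg R (i + 1, j)) := by
    intro j
    by_cases hj : (j - c.2).val < b
    · refine cyc_bonds_le (c := c.1) (a := a) (r := fun i => cfg R (i, j))
        (u := fun i => τ (i, j)) (fun i => ?_) (fun i => hle _) ?_
      · simp [cfg, hR, box, hj]
      · by_contra hcon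
        push Not at hcon
        have := le_holes hc ha hb hj (τ := τ) (fun x _ hx => by
          have : x.2 = j := sub_left_injective (ZMod.val_injective L hx)
          have h2 := hcon x.1
          rw [← this] at h2
          simpa using h2)
        rw [← hR] at this; omega
    · have h1 : ∀ i, cfg R (i, j) = false := fun i => by simp [cfg, hR, box, hj]
      have h2 : ∀ i, τ (i, j) = false := fun i => hτ _ (by simpa [cfg] using h1 i)
      simp [h1, h2]
  have hcol : ∀ i : ZMod L, ∑ j : ZMod L, spin (τ (i, j)) * spin (τ (i, j + 1))
      ≤ ∑ j : ZMod L, spin (cfg R (i, j)) * spin (cfg R (i, j + 1)) := by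
    intro i
    by_cases hi : (i - c.1).val < a
    · refine cyc_bonds_le (c := c.2) (a := b) (r := fun j => cfg R (i, j))
        (u := fun j => τ (i, j)) (fun j => ?_) (fun j => hle _) ?_
      · simp [cfg, hR, box, hi]
      · by_contra hcon
        push Not at hcon
        have := le_holes hc.swap hb ha hi (τ := τ) (fun x _ hx => by
          have : x.1 = i := sub_left_injective (ZMod.val_injective L hx)
          have h2 := hcon x.2
          rw [← this] at h2
          simpa using h2)
        rw [box_swap, ← hR] at this; omega
    · have h1 : ∀ j, cfg R (i, j) = false := fun j => by simp [cfg, hR, box, hi]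
      have h2 : ∀ j, τ (i, j) = false := fun j => hτ _ (by simpa [cfg] using h1 j)
      simp [h1, h2]
  have hsplit : ∀ τ : Config L, isingW h τ
      = ∑ j : ZMod L, ∑ i : ZMod L, spin (τ (i, j)) * spin (τ (i + 1, j))
        + ∑ i : ZMod L, ∑ j : ZMod L, spin (τ (i, j)) * spin (τ (i, j + 1))
        + h * ∑ x, spin (τ x) := by
    intro τ
    rw [isingW, Finset.sum_comm, ← Finset.sum_add_distrib, Fintype.sum_prod_type]
    congr 1
    refine Finset.sum_congr rfl fun i _ => ?_
    rw [← Finset.sum_add_distrib]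
    exact Finset.sum_congr rfl fun j _ => by simp [east, north, mul_add]
  rw [hsplit, hsplit, hsum]
  have h1 := Finset.sum_le_sum fun j (_ : j ∈ Finset.univ) => hrow j
  have h2 := Finset.sum_le_sum fun j (_ : j ∈ Finset.univ) => hcol j
  linarith

end IsingWeight

section RestrictedIsing

variable {L : ℕ} [NeZero L] {β h : ℝ} {R : Set (Site L)}

omit [NeZero L] in
lemma nnS_update (hL : 2 ≤ L) (τ : Config L) (x : Site L) (b : Bool) :
    nnS (Function.update τ x b) x = nnS τ x := by
  have : Fact (1 < L) := ⟨hL⟩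
  have hone : (1 : ZMod L) ≠ 0 := one_ne_zero
  have hE : east L ≠ 0 := fun hh => hone (congrArg Prod.fst hh)
  have hN : north L ≠ 0 := fun hh => hone (congrArg Prod.snd hh)
  simp [nnS, hE, hN]

omit [NeZero L] in
lemma flipP_update (hL : 2 ≤ L) (τ : Config L) (x : Site L) (a b : Bool) :
    flipP β h (Function.update τ x b) x a = flipP β h τ x a := by
  rw [flipP, flipP, nnS_update hL]

/-- Single-site update of the Ising dynamics restricted to `R`. -/
noncomputable def micro (β h : ℝ) (R : Set (Site L)) (x : Site L) :
    Module.End ℝ (Config L → ℝ) where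
  toFun g := fun τ => if x ∈ R then flipP β h τ x true * g (Function.update τ x true)
    + flipP β h τ x false * g (Function.update τ x false) else g (Function.update τ x false)
  map_add' f g := by funext τ; simp only [Pi.add_apply]; split_ifs <;> ring
  map_smul' t g := by
    funext τ
    simp only [Pi.smul_apply, smul_eq_mul, RingHom.id_apply]
    split_ifs <;> ring

omit [NeZero L] in
lemma micro_apply (R : Set (Site L)) (x : Site L) (g : Config L → ℝ) (τ : Config L) :
    micro β h R x g τ = if x ∈ R then flipP β h τ x true * g (Function.update τ x true)
      + flipP β h τ x false * g (Function.update τ x false)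
      else g (Function.update τ x false) := rfl

omit [NeZero L] in
lemma isMarkov_micro (R : Set (Site L)) (x : Site L) : IsMarkov (micro β h R x) where
  mono f g hfg τ := by
    rw [micro_apply, micro_apply]
    split_ifs
    · exact add_le_add (mul_le_mul_of_nonneg_left (hfg _) (flipP_pos β h τ x _).le)
        (mul_le_mul_of_nonneg_left (hfg _) (flipP_pos β h τ x _).le)
    · exact hfg _
  map_one := by
    funext τ
    rw [micro_apply]
    split_ifs
    · simpa using flipP_add β h τ x
    · rfl

/-- A sequence of single-site updates. -/
noncomputable def sweep (β h : ℝ) (R : Set (Site L)) (l : List (Site L)) :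
    Module.End ℝ (Config L → ℝ) := (l.map (micro β h R)).prod

omit [NeZero L] in
lemma sweep_cons (x : Site L) (l : List (Site L)) :
    sweep β h R (x :: l) = micro β h R x * sweep β h R l := by simp [sweep]

omit [NeZero L] in
lemma sweep_append (l l' : List (Site L)) :
    sweep β h R (l ++ l') = sweep β h R l * sweep β h R l' := by simp [sweep]

omit [NeZero L] in
lemma isMarkov_sweep (l : List (Site L)) : IsMarkov (sweep β h R l) := by
  induction l with
  | nil => exact (isMarkov_micro (β := β) (h := h) R 0).pow 0
  | cons x l ih => rw [sweep_cons]; exact (isMarkov_micro R x).mul ih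

lemma sum_update_eq (x : Site L) {F G : Config L → ℝ}
    (hFG : ∀ τ, F (Function.update τ x true) + F (Function.update τ x false)
      = G (Function.update τ x true) + G (Function.update τ x false)) :
    ∑ τ, F τ = ∑ τ, G τ := by
  have hinv : Function.Involutive fun τ : Config L => Function.update τ x (!(τ x)) := by
    intro τ; simp
  have hdouble : ∀ F : Config L → ℝ, 2 * ∑ τ, F τ
      = ∑ τ, (F (Function.update τ x true) + F (Function.update τ x false)) := by
    intro F
    have h1 := Equiv.sum_comp (hinv.toPerm _) F
    have h2 : ∀ τ : Config L, F (Function.update τ x true) + F (Function.update τ x false)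
        = F τ + F ((hinv.toPerm _) τ) := by
      intro τ
      have hself : Function.update τ x (τ x) = τ := Function.update_eq_self x τ
      change _ = F τ + F (Function.update τ x (!(τ x)))
      conv_rhs => rw [← hself]
      cases τ x <;> simp [add_comm]
    simp only [h2, Finset.sum_add_distrib]
    rw [h1]; ring
  have h1 := hdouble F
  have h2 := hdouble G
  simp only [hFG] at h1
  linarith

/-- The Gibbs weight of the Ising model in `R` with minus boundary conditions. -/
noncomputable def gibbs (β h : ℝ) (R : Set (Site L)) (τ : Config L) : ℝ :=
  if ∀ x ∉ R, τ x = false then Real.exp (β * isingW h τ) else 0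

lemma gibbs_nonneg (R : Set (Site L)) (τ : Config L) : 0 ≤ gibbs β h R τ := by
  unfold gibbs; split_ifs
  · positivity
  · exact le_rfl

lemma gibbs_mul_flipP (hL : 2 ≤ L) {x : Site L} (hx : x ∈ R) (τ : Config L) :
    (gibbs β h R (Function.update τ x true) + gibbs β h R (Function.update τ x false))
      * flipP β h τ x true = gibbs β h R (Function.update τ x true) := by
  have hiff : ∀ b, (∀ y ∉ R, Function.update τ x b y = false) ↔ ∀ y ∉ R, τ y = false := by
    intro b
    refine forall₂_congr fun y hy => ?_
    rw [Function.update_of_ne (fun hh => hy (by rwa [hh]))]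
  unfold gibbs
  rw [if_congr (hiff true) rfl rfl, if_congr (hiff false) rfl rfl]
  split_ifs
  · have h1 : Real.exp (β * isingW h (Function.update τ x false))
        = Real.exp (β * isingW h (Function.update τ x true))
          * Real.exp (-2 * β * spin true * (nnS τ x + h)) := by
      rw [← Real.exp_add]
      congr 1
      have := isingW_update (h := h) hL τ x
      simp only [spin, if_true]
      linear_combination (-β) * this
    rw [h1, flipP]
    set E := Real.exp (-2 * β * spin true * (nnS τ x + h))
    have hE : 0 < E := Real.exp_pos _
    field_simp
  · simp

lemma sum_gibbs_micro (hL : 2 ≤ L) (x : Site L) (g : Config L → ℝ) :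
    ∑ τ, gibbs β h R τ * micro β h R x g τ = ∑ τ, gibbs β h R τ * g τ := by
  refine sum_update_eq x fun τ => ?_
  simp only [micro_apply, Function.update_idem, flipP_update hL]
  by_cases hx : x ∈ R
  · simp only [hx, if_true]
    have h1 := gibbs_mul_flipP (β := β) (h := h) hL hx τ
    have h2 := flipP_add β h τ x
    have h3 : flipP β h τ x false = 1 - flipP β h τ x true := by linarith
    rw [h3]
    linear_combination (g (Function.update τ x true) - g (Function.update τ x false)) * h1
  · simp only [hx, if_false]
    have : gibbs β h R (Function.update τ x true) = 0 := by
      rw [gibbs, if_neg]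
      intro hh
      simpa using hh x hx
    rw [this]; ring

lemma sum_gibbs_sweep (hL : 2 ≤ L) (l : List (Site L)) (g : Config L → ℝ) :
    ∑ τ, gibbs β h R τ * sweep β h R l g τ = ∑ τ, gibbs β h R τ * g τ := by
  induction l with
  | nil => simp [sweep]
  | cons x l ih => rw [sweep_cons]; exact (sum_gibbs_micro hL x _).trans ih

/-- Stationary bound for the restricted dynamics started from the full set `R`. -/
lemma gibbs_mul_sweep_le (hL : 2 ≤ L) (l : List (Site L)) (G : Set (Config L)) :
    gibbs β h R (cfg R) * sweep β h R l (ind G) (cfg R) ≤ ∑ τ, gibbs β h R τ * ind G τ := by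
  rw [← sum_gibbs_sweep hL l]
  exact Finset.single_le_sum (f := fun τ => gibbs β h R τ * sweep β h R l (ind G) τ)
    (fun τ _ => mul_nonneg (gibbs_nonneg R τ) ((isMarkov_sweep l).ind_nonneg G τ))
    (Finset.mem_univ (cfg R))

lemma holes_cfg : holes R (cfg R) = 0 := by
  simp [holes, cfg]

lemma holes_update_le (τ : Config L) (x : Site L) (b : Bool) :
    holes R (Function.update τ x b) ≤ holes R τ + 1 := by
  unfold holes
  refine (Finset.card_le_card (t := insert x (Finset.univ.filter fun y => y ∈ R ∧ τ y = false))
    fun y hy => ?_).trans (Finset.card_insert_le _ _)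
  rw [Finset.mem_insert]
  by_cases hyx : y = x
  · exact Or.inl hyx
  · right; simpa [hyx] using hy

lemma micro_holes_le (k : ℕ) (x : Site L) :
    micro β h R x (ind {τ | k < holes R τ})
      ≤ ind {τ | k < holes R τ} + ind {τ | holes R τ = k} := by
  intro τ
  have hM := isMarkov_micro (β := β) (h := h) R x
  by_cases h1 : k ≤ holes R τ
  · have h2 := hM.ind_le_one {τ | k < holes R τ} τ
    have : ind {τ | k < holes R τ} τ + ind {τ | holes R τ = k} τ = 1 := by
      rcases h1.eq_or_lt with h3 | h3
      · simp [ind, h3]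
      · simp [ind, h3, h3.ne']
    rw [Pi.add_apply, this]; exact h2
  · have h2 : ∀ b, ind {τ | k < holes R τ} (Function.update τ x b) = 0 := by
      intro b
      have := holes_update_le (R := R) τ x b
      simp only [ind, Set.mem_ofPred_eq]
      rw [if_neg]; omega
    rw [micro_apply]
    simp only [h2, mul_zero, add_zero, ite_self]
    exact add_nonneg (ind_nonneg _ _) (ind_nonneg _ _)

/-- The restricted dynamics must cross the level `k` to accumulate more than `k` holes. -/
lemma gibbs_mul_sweep_holes_le (hL : 2 ≤ L) (k : ℕ) (l : List (Site L)) :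
    gibbs β h R (cfg R) * sweep β h R l (ind {τ | k < holes R τ}) (cfg R)
      ≤ l.length * ∑ τ, gibbs β h R τ * ind {τ | holes R τ = k} τ := by
  induction l using List.reverseRecOn with
  | nil => simp [sweep, ind, holes_cfg]
  | append_singleton l x ih =>
    have h1 := (isMarkov_sweep (β := β) (h := h) (R := R) l).mono _ _
      (micro_holes_le (β := β) (h := h) (R := R) k x) (cfg R)
    rw [map_add, Pi.add_apply] at h1
    have h2 := gibbs_mul_sweep_le (β := β) (h := h) (R := R) hL l {τ | holes R τ = k}
    have h3 : sweep β h R (l ++ [x]) (ind {τ | k < holes R τ})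
        = sweep β h R l (micro β h R x (ind {τ | k < holes R τ})) := by
      rw [sweep_append]; simp [sweep]
    rw [h3]
    have h4 := mul_le_mul_of_nonneg_left h1 (gibbs_nonneg (β := β) (h := h) R (cfg R))
    simp only [List.length_append, List.length_singleton]
    push_cast
    linarith

end RestrictedIsing

section Comparison

variable {L : ℕ} [NeZero L] {β h : ℝ} {R : Set (Site L)}

/-- Resampling of the spin at `x` of the updated configuration, given the old one `ρ`. -/
noncomputable def resample (β h : ℝ) (ρ : Config L) (x : Site L) (f : Config L → ℝ) :
    Config L → ℝ := fun η =>
  flipP β h ρ x true * f (Function.update η x true)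
    + flipP β h ρ x false * f (Function.update η x false)

lemma Pmat_update (ρ η : Config L) (x : Site L) (b : Bool) :
    Pmat β h ρ (Function.update η x b)
      = flipP β h ρ x b * ∏ y ∈ Finset.univ.erase x, flipP β h ρ y (η y) := by
  rw [Pmat, ← Finset.mul_prod_erase _ _ (Finset.mem_univ x), Function.update_self]
  congr 1
  refine Finset.prod_congr rfl fun y hy => ?_
  rw [Function.update_of_ne (Finset.ne_of_mem_erase hy)]

lemma avgOp_resample (ρ : Config L) (x : Site L) (f : Config L → ℝ) :
    avgOp L β h (resample β h ρ x f) ρ = avgOp L β h f ρ := by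
  rw [avgOp_apply, avgOp_apply]
  refine sum_update_eq x fun η => ?_
  simp only [Pmat_update, resample, Function.update_idem]
  have h1 := flipP_add β h ρ x
  have h2 : flipP β h ρ x false = 1 - flipP β h ρ x true := by linarith
  rw [h2]; ring

lemma avgOp_foldr_resample (ρ : Config L) (l : List (Site L)) (f : Config L → ℝ) :
    avgOp L β h (l.foldr (resample β h ρ) f) ρ = avgOp L β h f ρ := by
  induction l with
  | nil => rfl
  | cons x l ih => rw [List.foldr_cons, avgOp_resample, ih]

omit [NeZero L] in
lemma flipP_true_mono (hβ : 0 ≤ β) {σ τ : Config L} {x : Site L} (hle : nnS τ x ≤ nnS σ x) :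
    flipP β h τ x true ≤ flipP β h σ x true := by
  unfold flipP
  apply one_div_le_one_div_of_le (by positivity)
  have : Real.exp (-2 * β * spin true * (nnS σ x + h))
      ≤ Real.exp (-2 * β * spin true * (nnS τ x + h)) := by
    apply Real.exp_le_exp.mpr
    simp only [spin, if_true]
    nlinarith
  linarith

/-- Coupling of the parallel update with sequential updates of a dominated configuration. -/
lemma foldr_resample_le_sweep (hL : 2 ∣ L) (hβ : 0 ≤ β) {e : ZMod 2} {ρ : Config L}
    {g g' : Config L → ℝ}
    (H : ∀ η τ : Config L, (∀ x ∈ subl L e, τ x ≤ ρ x) → (∀ x ∈ subl L (e + 1), τ x ≤ η x) →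
      g η ≤ g' τ)
    (l : List (Site L)) (hl : ∀ x ∈ l, x ∈ subl L (e + 1)) :
    ∀ η τ : Config L, (∀ x ∈ subl L e, τ x ≤ ρ x) →
      (∀ x ∈ subl L (e + 1), x ∉ l → τ x ≤ η x) →
      l.foldr (resample β h ρ) g η ≤ sweep β h R l g' τ := by
  induction l with
  | nil => intro η τ h1 h2; exact H η τ h1 (fun x hx => h2 x hx (by simp))
  | cons x l ih =>
    intro η τ h1 h2
    have hx := hl x (by simp)
    have hxe : x ∉ subl L e := by
      intro hh
      have h3 : par x = e := hh
      have h4 : par x = e + 1 := hx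
      rw [h3] at h4
      revert h4; generalize e = e; revert e; decide
    have key : ∀ b' b : Bool, b' ≤ b →
        l.foldr (resample β h ρ) g (Function.update η x b)
          ≤ sweep β h R l g' (Function.update τ x b') := by
      intro b' b hbb
      refine ih (fun y hy => hl y (by simp [hy])) _ _ (fun y hy => ?_) (fun y hy hyl => ?_)
      · rw [Function.update_of_ne (fun hh => hxe (by rwa [← hh]))]
        exact h1 y hy
      · by_cases hyx : y = x
        · subst hyx; simpa using hbb
        · rw [Function.update_of_ne hyx, Function.update_of_ne hyx]
          exact h2 y hy (by simp [hyx, hyl])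
    rw [List.foldr_cons, sweep_cons, Module.End.mul_apply, micro_apply, resample]
    have hq := flipP_true_mono (h := h) hβ (nnS_mono_subl hL h1 hx)
    have hp1 := flipP_add β h ρ x
    have hq1 := flipP_add β h τ x
    have hp := flipP_pos β h ρ x true
    have hp' := flipP_pos β h ρ x false
    have hq0 := flipP_pos β h τ x true
    have k1 := key true true le_rfl
    have k2 := key false false le_rfl
    have k3 := key false true (by decide)
    set Fp := l.foldr (resample β h ρ) g (Function.update η x true)
    set Fm := l.foldr (resample β h ρ) g (Function.update η x false)
    split_ifs
    · have m1 := mul_le_mul_of_nonneg_left k1 hq0.le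
      have m2 := mul_le_mul_of_nonneg_left k2 hp'.le
      have m3 := mul_le_mul_of_nonneg_left k3 (sub_nonneg.mpr hq)
      have e1 : flipP β h τ x false
        = (flipP β h ρ x true - flipP β h τ x true) + flipP β h ρ x false := by linarith
      rw [e1]
      linarith
    · have m2 := mul_le_mul_of_nonneg_left k2 hp'.le
      have m3 := mul_le_mul_of_nonneg_left k3 hp.le
      calc _ ≤ flipP β h ρ x true * sweep β h R l g' (Function.update τ x false)
            + flipP β h ρ x false * sweep β h R l g' (Function.update τ x false) :=
            add_le_add m3 m2
        _ = _ := by rw [← add_mul, hp1, one_mul]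

/-- `g` at any configuration is bounded by `g'` at any configuration dominated on parity `e`. -/
def DomBy (e : ZMod 2) (g g' : Config L → ℝ) : Prop :=
  ∀ ρ τ : Config L, (∀ x ∈ subl L e, τ x ≤ ρ x) → g ρ ≤ g' τ

lemma DomBy.avgOp (hL : 2 ∣ L) (hβ : 0 ≤ β) {e : ZMod 2} {g g' : Config L → ℝ}
    (H : DomBy (e + 1) g g') (R : Set (Site L)) :
    DomBy e (PCA.avgOp L β h g)
      (sweep β h R (Finset.univ.filter (· ∈ subl L (e + 1))).toList g') := by
  intro ρ τ hle
  rw [← avgOp_foldr_resample ρ (Finset.univ.filter (· ∈ subl L (e + 1))).toList]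
  refine (isMarkov_avgOp L β h).le_of_le_const (fun η => ?_) ρ
  refine foldr_resample_le_sweep hL hβ (fun η τ _ h2 => H η τ h2) _ (fun x hx => ?_) η τ hle
    (fun x hx hxl => absurd ?_ hxl)
  · simpa using hx
  · simpa using hx

lemma DomBy.avgOp_pow (hL : 2 ∣ L) (hβ : 0 ≤ β) (R : Set (Site L)) {g g' : Config L → ℝ}
    (N : ℕ) : ∀ e : ZMod 2, DomBy (e + N) g g' →
    ∃ l : List (Site L), l.length ≤ N * Fintype.card (Site L) ∧
      DomBy e ((PCA.avgOp L β h ^ N) g) (sweep β h R l g') := by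
  induction N with
  | zero =>
    intro e H
    refine ⟨[], by simp, ?_⟩
    simpa [sweep] using H
  | succ N ih =>
    intro e H
    obtain ⟨l, hl, hd⟩ := ih (e + 1) (by
      convert H using 1; push_cast; ring)
    refine ⟨(Finset.univ.filter (· ∈ subl L (e + 1))).toList ++ l, ?_, ?_⟩
    · rw [List.length_append, Finset.length_toList]
      have := Finset.card_le_univ (Finset.univ.filter (· ∈ subl L (e + 1)))
      rw [add_mul, one_mul]
      omega
    · rw [pow_succ', Module.End.mul_apply, sweep_append, Module.End.mul_apply]
      exact hd.avgOp hL hβ R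

/-- Survival of a plus rectangle: it stays essentially intact on a sublattice for times much
shorter than the exponential of the cost of `k` holes. -/
lemma survival (hL : 2 ∣ L) (hβ : 0 ≤ β) (h0 : 0 < h) {c : Site L} {a b k : ℕ} (ha : a ≤ L)
    (hb : b ≤ L) (hka : k < a) (hkb : k < b)
    (hR : R = box (fun x => (x.1 - c.1).val) (fun x => (x.2 - c.2).val) a b)
    {e : ZMod 2} {σ : Config L} (hσ : σ ∈ Lo e R) (N : ℕ) :
    (avgOp L β h ^ N) (ind (Lo (e + N) R)ᶜ) σ
      ≤ Fintype.card (Config L) * Real.exp (-2 * β * h)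
        + N * Fintype.card (Site L) * (Fintype.card (Config L) * Real.exp (-2 * β * h * k)) := by
  have hL2 : 2 ≤ L := Nat.le_of_dvd (Nat.pos_of_ne_zero (NeZero.ne L)) hL
  have H : DomBy (e + N) (ind (Lo (e + N) R)ᶜ) (ind {τ | 1 ≤ holes R τ}) := by
    intro ρ τ hle
    by_cases hρ : ρ ∈ Lo (e + N) R
    · have : ind (Lo (e + N) R)ᶜ ρ = 0 := by simp [ind, hρ]
      rw [this]; exact ind_nonneg _ _
    · refine (ind_le_one _ _).trans ?_
      rw [Lo, Set.mem_ofPred_eq] at hρ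
      push Not at hρ
      obtain ⟨x, hx, hne⟩ := hρ
      have h1 : ρ x = false := by simpa using hne
      have h2 : τ x = false := by
        have := hle x hx.1
        rw [h1] at this; exact le_antisymm this (Bool.false_le _)
      have h3 : 1 ≤ holes R τ := Finset.card_pos.mpr ⟨x, by simp [hx.2, h2]⟩
      simp [ind, h3]
  obtain ⟨l, hl, hd⟩ := H.avgOp_pow (h := h) hL hβ R N e
  have h1 := hd σ (cfg R) (fun x hx => by
    by_cases hxR : x ∈ R
    · rw [hσ x ⟨hx, hxR⟩]; exact Bool.le_true _
    · simp [cfg, hxR])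
  refine h1.trans ?_
  have hsplit : ind {τ | 1 ≤ holes R τ}
      ≤ ind {τ | 1 ≤ holes R τ ∧ holes R τ ≤ k} + ind {τ | k < holes R τ} := by
    intro τ
    simp only [ind, Pi.add_apply, Set.mem_ofPred_eq]
    split_ifs <;> first | omega | norm_num
  have h2 := (isMarkov_sweep (β := β) (h := h) (R := R) l).mono _ _ hsplit (cfg R)
  rw [map_add, Pi.add_apply] at h2
  refine h2.trans ?_
  have hZ : gibbs β h R (cfg R) = Real.exp (β * isingW h (cfg R)) := by
    rw [gibbs, if_pos]; intro x hx; simp [cfg, hx]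
  have hZpos : 0 < gibbs β h R (cfg R) := by rw [hZ]; positivity
  have hpt : ∀ τ : Config L, holes R τ ≤ k → gibbs β h R τ
      ≤ gibbs β h R (cfg R) * Real.exp (-2 * β * h * holes R τ) := by
    intro τ hτ
    by_cases hτR : ∀ x ∉ R, τ x = false
    · rw [hZ, gibbs, if_pos hτR, ← Real.exp_add]
      apply Real.exp_le_exp.mpr
      have := isingW_le (h := h) hL ha hb hR hτR (by omega) (by omega)
      nlinarith
    · rw [gibbs, if_neg hτR]; positivity
  have hmass : ∀ (m : ℕ) (G : Set (Config L)),
      (∀ τ ∈ G, m ≤ holes R τ ∧ holes R τ ≤ k) →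
      ∑ τ, gibbs β h R τ * ind G τ ≤ gibbs β h R (cfg R) *
        (Fintype.card (Config L) * Real.exp (-2 * β * h * m)) := by
    intro m G hG
    have : ∀ τ ∈ (Finset.univ : Finset (Config L)), gibbs β h R τ * ind G τ
        ≤ gibbs β h R (cfg R) * Real.exp (-2 * β * h * m) := by
      intro τ _
      by_cases hτ : τ ∈ G
      · obtain ⟨hm, hk⟩ := hG τ hτ
        have h3 : ind G τ = 1 := by simp [ind, hτ]
        rw [h3, mul_one]
        refine (hpt τ hk).trans (mul_le_mul_of_nonneg_left (Real.exp_le_exp.mpr ?_) hZpos.le)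
        have h4 : (m : ℝ) ≤ holes R τ := by exact_mod_cast hm
        have h5 : 0 ≤ β * h := by positivity
        nlinarith
      · have h3 : ind G τ = 0 := by simp [ind, hτ]
        rw [h3, mul_zero]; positivity
    refine (Finset.sum_le_card_nsmul _ _ _ this).trans (le_of_eq ?_)
    rw [nsmul_eq_mul, Finset.card_univ]; ring
  have b1 := (gibbs_mul_sweep_le (β := β) (h := h) (R := R) hL2 l
    {τ | 1 ≤ holes R τ ∧ holes R τ ≤ k}).trans (hmass 1 _ fun τ hτ => hτ)
  have b2 := (gibbs_mul_sweep_holes_le (β := β) (h := h) (R := R) hL2 k l).trans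
    (mul_le_mul_of_nonneg_left (hmass k {τ | holes R τ = k} fun τ hτ => ⟨ge_of_eq hτ, le_of_eq hτ⟩)
      (Nat.cast_nonneg _))
  rw [mul_left_comm] at b2
  have b1' := le_of_mul_le_mul_left b1 hZpos
  have b2' := le_of_mul_le_mul_left b2 hZpos
  rw [Nat.cast_one, mul_one] at b1'
  refine add_le_add b1' (b2'.trans (mul_le_mul_of_nonneg_right ?_ (by positivity)))
  exact_mod_cast hl

end Comparison

section Seas

variable {L : ℕ} [NeZero L] {h : ℝ}

omit [NeZero L] in
lemma int_eq_of_cast_eq {m d : ℤ} (hm : |m - d| < L) (hc : (m : ZMod L) = d) : m = d := by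
  have h1 : (L : ℤ) ∣ m - d := (ZMod.intCast_eq_intCast_iff_dvd_sub d m L).mp hc.symm
  linarith [Int.eq_zero_of_abs_lt_dvd h1 hm]

/-- A periodic walk on a cycle that visits a fixed short arc at least every second step does not
wind. -/
lemma sum_eq_zero_of_arc {z : ℕ → ZMod L} {d : ℕ → ℤ} {good : ℕ → Prop} {a n : ℕ}
    (ha : a + 2 ≤ L) (hz : ∀ i, z (i + 1) = z i + d i) (hd : ∀ i, |d i| ≤ 1)
    (hgood : ∀ i, good i ∨ good (i + 1)) (harc : ∀ i, good i → (z i).val < a)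
    (hzp : ∀ i, z (i + n) = z i) (hdp : ∀ i, d (i + n) = d i)
    (hgp : ∀ i, good (i + n) ↔ good i) : ∑ i ∈ Finset.range n, d i = 0 := by
  set u : ℕ → ℤ := fun i => ((z i).val : ℤ) with hu
  have hcast : ∀ i, ((u i : ℤ) : ZMod L) = z i := fun i => by simp [hu]
  set φ : ℕ → ℤ := fun i => if good i then u i else u (i + 1) - d i with hφ
  have hub : ∀ i, good i → 0 ≤ u i ∧ u i < a := fun i hi =>
    ⟨by positivity, by simp only [hu]; exact_mod_cast harc i hi⟩
  have hstep : ∀ i, d i = φ (i + 1) - φ i := by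
    intro i
    have hdi := abs_le.mp (hd i)
    have hdj := abs_le.mp (hd (i + 1))
    by_cases h1 : good i
    · have b1 := hub i h1
      by_cases h2 : good (i + 1)
      · have b2 := hub _ h2
        simp only [hφ, if_pos h1, if_pos h2]
        refine (int_eq_of_cast_eq (L := L) (abs_lt.mpr ⟨by omega, by omega⟩) ?_).symm
        push_cast
        rw [hcast, hcast, hz]; ring
      · have h3 : good (i + 1 + 1) := (hgood (i + 1)).resolve_left h2
        have b3 := hub _ h3
        simp only [hφ, if_pos h1, if_neg h2]
        refine (int_eq_of_cast_eq (L := L) (abs_lt.mpr ⟨by omega, by omega⟩) ?_).symm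
        push_cast
        rw [hcast, hcast, hz, hz]; ring
    · have h2 : good (i + 1) := (hgood i).resolve_left h1
      simp only [hφ, if_neg h1, if_pos h2]
      ring
  rw [Finset.sum_congr rfl fun i _ => hstep i, Finset.sum_range_sub]
  have h0 : φ n = φ 0 := by
    have e1 := hzp 0
    have e2 := hzp 1
    have e3 := hdp 0
    have e4 := hgp 0
    rw [zero_add] at e1 e3 e4
    rw [add_comm 1 n] at e2
    simp only [hφ, hu, zero_add, e1, e2, e3, e4]
  rw [h0, sub_self]

lemma not_wrapping {X : Set (Site L)} {c : Site L} {a b : ℕ} (ha : a + 2 ≤ L) (hb : b + 2 ≤ L)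
    (hX : ∀ x ∈ X, ∀ d ∈ stepSet, x ∈ rect c a b ∨
      (x + ((d.1 : ZMod L), (d.2 : ZMod L)) ∈ X →
        x + ((d.1 : ZMod L), (d.2 : ZMod L)) ∈ rect c a b)) : ¬ Wrapping X := by
  rintro ⟨n, f, d, hn, hf, hne, hs⟩
  have hlt : ∀ i, i % n < n := fun i => Nat.mod_lt _ hn
  have hstep : ∀ i, f ((i + 1) % n) = f (i % n) + (((d (i % n)).1 : ZMod L),
      ((d (i % n)).2 : ZMod L)) := by
    intro i
    rw [← (hs _ (hlt i)).2.1]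
    have h1 := hlt i
    rw [Nat.add_mod]
    by_cases h2 : i % n + 1 = n
    · rw [h2, hf]
      by_cases hn1 : n = 1
      · subst hn1; simp [Nat.mod_one]
      · rw [Nat.mod_eq_of_lt (a := 1) (by omega), h2, Nat.mod_self]
    · rw [Nat.mod_eq_of_lt (a := 1) (by omega), Nat.mod_eq_of_lt (by omega)]
  have hgood : ∀ i, f (i % n) ∈ rect c a b ∨ f ((i + 1) % n) ∈ rect c a b := by
    intro i
    rcases hX _ (hs _ (hlt i)).2.2 _ (hs _ (hlt i)).1 with h1 | h1
    · exact Or.inl h1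
    · rw [← hstep] at h1
      exact Or.inr (h1 (hs _ (hlt (i + 1))).2.2)
  have hbox : ∀ x, x ∈ rect c a b → (x.1 - c.1).val < a ∧ (x.2 - c.2).val < b := by
    intro x hx
    rw [rect_eq_box c (by omega) (by omega)] at hx
    exact hx
  have hd : ∀ i, |(d (i % n)).1| ≤ 1 ∧ |(d (i % n)).2| ≤ 1 := by
    intro i
    have := (hs _ (hlt i)).1
    simp only [stepSet, Set.mem_insert_iff, Set.mem_singleton_iff] at this
    rcases this with h1 | h1 | h1 | h1 <;> rw [h1] <;> simp
  have s1 : ∑ i ∈ Finset.range n, (d (i % n)).1 = 0 :=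
    sum_eq_zero_of_arc (z := fun i => (f (i % n)).1 - c.1) (good := fun i => f (i % n) ∈ rect c a b)
      ha (fun i => by simp only [hstep i, Prod.fst_add]; ring) (fun i => (hd i).1) hgood
      (fun i hi => (hbox _ hi).1) (fun i => by simp) (fun i => by simp) (fun i => by simp)
  have s2 : ∑ i ∈ Finset.range n, (d (i % n)).2 = 0 :=
    sum_eq_zero_of_arc (z := fun i => (f (i % n)).2 - c.2) (good := fun i => f (i % n) ∈ rect c a b)
      hb (fun i => by simp only [hstep i, Prod.snd_add]; ring) (fun i => (hd i).2) hgood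
      (fun i hi => (hbox _ hi).2) (fun i => by simp) (fun i => by simp) (fun i => by simp)
  apply hne
  have hmod : ∀ i ∈ Finset.range n, i % n = i := fun i hi =>
    Nat.mod_eq_of_lt (Finset.mem_range.mp hi)
  ext
  · rw [Prod.fst_sum, Prod.fst_zero, ← s1]
    exact Finset.sum_congr rfl fun i hi => by rw [hmod i hi]
  · rw [Prod.snd_sum, Prod.snd_zero, ← s2]
    exact Finset.sum_congr rfl fun i hi => by rw [hmod i hi]

/-- The chessboard that is plus on the sites of parity `e`. -/
noncomputable def chess (L : ℕ) (e : ZMod 2) : Config L := fun x => decide (par x = e)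

omit [NeZero L] in
lemma chess_zero : chess L 0 = chessE L := by
  ext x
  simp only [chess, chessE, par, ZMod.natCast_eq_zero_iff, Nat.dvd_iff_mod_eq_zero]

omit [NeZero L] in
lemma chess_one : chess L 1 = chessO L := by
  ext x
  have h2 : ∀ e : ZMod 2, decide (e = 1) = !decide (e = 0) := by decide
  have h3 := congrFun (chess_zero (L := L)) x
  simp only [chess] at h3
  rw [chessO, ← h3, chess, ← h2]

omit [NeZero L] in
lemma seaChessAny_iff {σ : Config L} :
    SeaChessAny h σ ↔ ∃ e : ZMod 2, SeaChess h (chess L e) σ := by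
  rw [SeaChessAny, ← chess_zero, ← chess_one]
  constructor
  · rintro (h1 | h1)
    exacts [⟨_, h1⟩, ⟨_, h1⟩]
  · rintro ⟨e, he⟩
    have : e = 0 ∨ e = 1 := by clear he; revert e; decide
    rcases this with rfl | rfl
    exacts [Or.inl he, Or.inr he]

lemma par_add_step (hL : 2 ∣ L) (x : Site L) {d : ℤ × ℤ} (hd : d ∈ stepSet) :
    par (x + ((d.1 : ZMod L), (d.2 : ZMod L))) = par x + 1 := by
  simp only [stepSet, Set.mem_insert_iff, Set.mem_singleton_iff] at hd
  rcases hd with rfl | rfl | rfl | rfl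
  · simpa [east] using par_add_east hL x
  · simpa [east, sub_eq_add_neg] using par_sub_east hL x
  · simpa [north] using par_add_north hL x
  · simpa [north, sub_eq_add_neg] using par_sub_north hL x

/-- Configurations with a well defined sea of pluses or of a chessboard. -/
def seas (L : ℕ) (h : ℝ) : Set (Config L) := {σ | SeaChessAny h σ} ∪ {σ | SeaPlus h σ}

lemma notMem_seas (hL : 2 ∣ L) {c : Site L} {a b : ℕ} (ha : a + 2 ≤ L) (hb : b + 2 ≤ L)
    {σ : Config L} (hσ : ∀ x ∉ rect c a b, σ x = false) : σ ∉ seas L h := by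
  have hin : ∀ x, σ x = true → x ∈ rect c a b := by
    intro x hx
    by_contra hn
    rw [hσ x hn] at hx
    exact absurd hx (by decide)
  rintro (h1 | ⟨X, hW, hX, -⟩)
  · obtain ⟨e, X, hW, hX, -⟩ := seaChessAny_iff.mp h1
    refine not_wrapping (c := c) ha hb (fun x hx d hd => ?_) hW
    by_cases he : par x = e
    · exact Or.inl (hin x (by rw [hX x hx]; simp [chess, he]))
    · refine Or.inr fun hy => hin _ ?_
      have : ∀ p e : ZMod 2, p ≠ e → p + 1 = e := by decide
      rw [hX _ hy]
      simp [chess, par_add_step hL x hd, this _ _ he]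
  · exact not_wrapping (c := c) ha hb (fun x hx d hd => Or.inl (hin x (hX x hx))) hW

lemma wrapping_univ : Wrapping (Set.univ : Set (Site L)) := by
  have hL := NeZero.ne L
  refine ⟨L, fun i => ((i : ZMod L), 0), fun _ => (1, 0), Nat.pos_of_ne_zero hL, by simp, ?_,
    fun i _ => ⟨by simp [stepSet], by simp, trivial⟩⟩
  simp [Finset.sum_const, Prod.ext_iff, hL]

lemma plusC_mem_seas (h0 : 0 < h) : plusC L ∈ seas L h := by
  refine Or.inr ⟨Set.univ, wrapping_univ, fun _ _ => rfl, fun n _ x _ => ?_⟩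
  have hT : T h (plusC L) = plusC L := by
    ext x
    have : nnS (plusC L) x = 4 := by simp [nnS, plusC, spin]; norm_num
    simp only [T, this, plusC]
    rw [if_pos (by linarith)]
  rw [Function.iterate_fixed hT]

lemma T_chess (hL : 2 ∣ L) (h0 : 0 < h) (h2 : h < 2) (e : ZMod 2) :
    T h (chess L e) = chess L (e + 1) := by
  ext x
  have key : ∀ p e : ZMod 2, p = e + 1 ↔ p + 1 = e := by decide
  by_cases hx : par x + 1 = e
  · have h4 : nnS (chess L e) x = 4 := by
      simp only [nnS, chess, par_add_east hL, par_add_north hL, par_sub_east hL, par_sub_north hL,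
        hx, spin]
      norm_num
    simp only [T, chess, key, hx, h4]
    simp [show (0 : ℝ) < 4 + h by linarith]
  · have h4 : nnS (chess L e) x = -4 := by
      simp only [nnS, chess, par_add_east hL, par_add_north hL, par_sub_east hL, par_sub_north hL,
        hx, spin]
      norm_num
    simp only [T, chess, key, hx, h4]
    simp [show ¬ (0 : ℝ) < -4 + h by linarith]

lemma chess_mem_seas (hL : 2 ∣ L) (h0 : 0 < h) (h2 : h < 2) (e : ZMod 2) :
    chess L e ∈ seas L h := by
  refine Or.inl (seaChessAny_iff.mpr ⟨e, Set.univ, wrapping_univ, fun _ _ => rfl,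
    fun n _ x _ => ?_⟩)
  have hT : (T h)^[2] (chess L e) = chess L e := by
    have key : e + 1 + 1 = e := by revert e; decide
    simp only [Function.iterate_succ, Function.iterate_zero, Function.comp, id,
      T_chess hL h0 h2, key]
  rw [Function.iterate_mul, Function.iterate_fixed hT]

end Seas

section Asymptotics

lemma tendsto_floor_exp_mul_exp {κ t : ℝ} (hκ : κ < 2 * t) :
    Tendsto (fun β : ℝ => (⌊Real.exp (β * κ)⌋₊ : ℝ) * Real.exp (-2 * β * t)) atTop (nhds 0) := by
  have h1 : Tendsto (fun β : ℝ => Real.exp (β * (κ - 2 * t))) atTop (nhds 0) :=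
    Real.tendsto_exp_atBot.comp (tendsto_id.atTop_mul_const_of_neg (by linarith))
  refine squeeze_zero (fun β => by positivity) (fun β => ?_) h1
  calc (⌊Real.exp (β * κ)⌋₊ : ℝ) * Real.exp (-2 * β * t)
      ≤ Real.exp (β * κ) * Real.exp (-2 * β * t) := by
        gcongr; exact Nat.floor_le (Real.exp_pos _).le
    _ = Real.exp (β * (κ - 2 * t)) := by rw [← Real.exp_add]; ring_nf

lemma tendsto_exp_neg_mul {t : ℝ} (ht : 0 < t) :
    Tendsto (fun β : ℝ => Real.exp (-2 * β * t)) atTop (nhds 0) := by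
  refine Real.tendsto_exp_atBot.comp ?_
  have h1 := tendsto_id.atTop_mul_const_of_neg (α := ℝ) (r := -2 * t) (by linarith)
  refine h1.congr fun β => ?_
  simp only [id]; ring

lemma tendsto_one_sub_pow_floor {w κ κ' : ℝ} (hw : 0 < w) (hw1 : w ≤ 1) (hκ : 0 ≤ κ)
    (hκ' : κ < κ') :
    Tendsto (fun β : ℝ => (1 - w * Real.exp (-β * κ)) ^ ⌊Real.exp (β * κ')⌋₊) atTop (nhds 0) := by
  have h1 : Tendsto (fun β : ℝ => w * Real.exp (β * (κ' - κ)) + -w) atTop atTop :=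
    tendsto_atTop_add_const_right _ _
      ((Real.tendsto_exp_atTop.comp (tendsto_id.atTop_mul_const (by linarith))).const_mul_atTop hw)
  have h2 := Real.tendsto_exp_neg_atTop_nhds_zero.comp h1
  refine squeeze_zero' ?_ ?_ h2
  all_goals
    filter_upwards [eventually_ge_atTop 0] with β hβ
    have he : Real.exp (-β * κ) ≤ 1 := Real.exp_le_one_iff.mpr (by nlinarith)
    have hp : w * Real.exp (-β * κ) ≤ 1 := by nlinarith [Real.exp_pos (-β * κ)]
  · exact pow_nonneg (by linarith) _
  · set n := ⌊Real.exp (β * κ')⌋₊ with hn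
    have hn1 : Real.exp (β * κ') - 1 ≤ n := by
      have := Nat.lt_floor_add_one (Real.exp (β * κ'))
      linarith
    have hb := Real.add_one_le_exp (-(w * Real.exp (-β * κ)))
    calc (1 - w * Real.exp (-β * κ)) ^ n ≤ Real.exp (-(w * Real.exp (-β * κ))) ^ n :=
          pow_le_pow_left₀ (by linarith) (by linarith) n
      _ = Real.exp (n * -(w * Real.exp (-β * κ))) := by rw [← Real.exp_nat_mul]
      _ ≤ _ := by
        simp only [Function.comp]
        apply Real.exp_le_exp.mpr
        have h3 : Real.exp (β * (κ' - κ)) = Real.exp (β * κ') * Real.exp (-β * κ) := by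
          rw [← Real.exp_add]; ring_nf
        have h4 := Real.exp_pos (-β * κ)
        rw [h3]
        have h5 : 0 ≤ w * Real.exp (-β * κ) * (n - (Real.exp (β * κ') - 1)) :=
          mul_nonneg (by positivity) (by linarith)
        nlinarith

variable {Ω : Type*}

lemma hitBy_le_one {Q : Module.End ℝ (Ω → ℝ)} (hQ : IsMarkov Q) (E : Set Ω) (N : ℕ) (ω : Ω) :
    hitBy Q E N ω ≤ 1 := by
  rw [← sum_firstHit_univ]; exact sum_firstHit_le_one hQ _ _ _ _

lemma hitBy_mono_set {Q : Module.End ℝ (Ω → ℝ)} (hQ : IsMarkov Q) {E F : Set Ω} (hEF : E ⊆ F)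
    (N : ℕ) : hitBy Q E N ≤ hitBy Q F N := by
  induction N with
  | zero => exact ind_mono hEF
  | succ N ih =>
    intro ω
    by_cases hF : ω ∈ F
    · simp only [hitBy, if_pos hF]
      exact hitBy_le_one hQ E (N + 1) ω
    · simp only [hitBy, if_neg hF, if_neg fun hE => hF (hEF hE)]
      exact hQ.mono _ _ ih ω

lemma ind_compl_le_add {A B G : Set Ω} (hG : A ∩ B ⊆ G) : ind Gᶜ ≤ ind Aᶜ + ind Bᶜ := by
  intro ω
  simp only [ind, Pi.add_apply, Set.mem_compl_iff]
  have : ω ∈ A ∧ ω ∈ B → ω ∈ G := fun hω => hG hω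
  split_ifs <;> first | (exfalso; tauto) | norm_num

lemma tendsto_compl_of_inter {Q : ℝ → Module.End ℝ (Ω → ℝ)} (hQ : ∀ β, IsMarkov (Q β))
    {N : ℝ → ℕ} {A B G : Set Ω} (hG : A ∩ B ⊆ G) {ω : Ω}
    (hA : Tendsto (fun β => (Q β ^ N β) (ind Aᶜ) ω) atTop (nhds 0))
    (hB : Tendsto (fun β => (Q β ^ N β) (ind Bᶜ) ω) atTop (nhds 0)) :
    Tendsto (fun β => (Q β ^ N β) (ind Gᶜ) ω) atTop (nhds 0) := by
  have h1 := hA.add hB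
  rw [add_zero] at h1
  refine squeeze_zero (fun β => ((hQ β).pow _).ind_nonneg _ _) (fun β => ?_) h1
  have h2 := ((hQ β).pow (N β)).mono _ _ (ind_compl_le_add hG) ω
  rwa [map_add, Pi.add_apply] at h2

lemma tendsto_hitBy_of_compl {Q : ℝ → Module.End ℝ (Ω → ℝ)} (hQ : ∀ β, IsMarkov (Q β))
    {N : ℝ → ℕ} {G : Set Ω} {ω : Ω}
    (hG : Tendsto (fun β => (Q β ^ N β) (ind Gᶜ) ω) atTop (nhds 0)) :
    Tendsto (fun β => hitBy (Q β) G (N β) ω) atTop (nhds 1) := by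
  have h1 := hG.const_sub 1
  rw [sub_zero] at h1
  refine tendsto_of_tendsto_of_tendsto_of_le_of_le h1 tendsto_const_nhds (fun β => ?_)
    (fun β => hitBy_le_one (hQ β) _ _ _)
  have h2 := pow_ind_le_hitBy (hQ β) G (N β) ω
  have h3 := ((hQ β).pow (N β)).apply_compl G ω
  simp only; linarith

/-- Successive relaxation through metastable stages. -/
lemma tendsto_stages {Q : ℝ → Module.End ℝ (Ω → ℝ)} (hQ : ∀ β, IsMarkov (Q β)) {G : ℕ → Set Ω}
    {S : ℕ} {n : ℝ → ℕ} {p δ : ℝ → ℝ} (hp : ∀ᶠ β in atTop, 0 ≤ p β ∧ p β ≤ 1 ∧ 0 ≤ δ β)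
    (hstay : ∀ᶠ β in atTop, ∀ i ≤ S, ∀ m ≤ n β, ∀ ω ∈ G i, (Q β ^ m) (ind (G i)ᶜ) ω ≤ δ β)
    (hgo : ∀ᶠ β in atTop, ∀ i < S, ∀ ω ∈ G i, Q β (ind (G (i + 1))ᶜ) ω ≤ 1 - p β)
    (hpn : Tendsto (fun β => (1 - p β) ^ n β) atTop (nhds 0)) (hδ : Tendsto δ atTop (nhds 0))
    {ω : Ω} (hω : ω ∈ G 0) :
    Tendsto (fun β => (Q β ^ (n β * S)) (ind (G S)ᶜ) ω) atTop (nhds 0) := by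
  have h1 := (hpn.add (hδ.const_mul 2)).const_mul (S : ℝ)
  rw [mul_zero, add_zero, mul_zero] at h1
  refine squeeze_zero' (Eventually.of_forall fun β => ((hQ β).pow _).ind_nonneg _ _) ?_ h1
  filter_upwards [hp, hstay, hgo] with β ⟨hp0, hp1, hδ0⟩ hs hg
  rw [pow_mul]
  refine ((hQ β).pow _).chain (fun i hi ω hω => ?_) ω hω
  exact (hQ β).relax hp0 hp1 hδ0 (fun m hm => hs i hi.le m hm) (fun m hm => hs (i + 1) hi m hm)
    (hg i hi) ω hω

variable {L : ℕ} [NeZero L] {h : ℝ}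

lemma tendsto_probHitBefore {σ : Config L} {A B : Set (Config L)} {N : ℝ → ℕ}
    (hA : Tendsto (fun β => hitBy (avgOp L β h) A (N β) σ) atTop (nhds 1))
    (hB : Tendsto (fun β => hitBy (avgOp L β h) B (N β) σ) atTop (nhds 0)) :
    Tendsto (fun β => probHitBefore β h σ A B) atTop (nhds 1) := by
  have h1 := hA.sub hB
  rw [sub_zero] at h1
  refine tendsto_of_tendsto_of_tendsto_of_le_of_le h1 tendsto_const_nhds (fun β => ?_)
    (fun β => probHitBefore_le_one σ A B)
  refine le_trans (sub_le_sub ?_ ?_) (le_probHitBefore σ A B (N β))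
  · exact hitBy_mono_set (isMarkov_avgOp L β h) Set.subset_union_left _ σ
  · refine hitBy_mono_set (isMarkov_avgOp L β h) (fun τ hτ => ?_) _ σ
    by_contra hB'
    exact hτ.2 ⟨hτ.1.resolve_right hB', hB'⟩

lemma tendsto_probTauIn {σ : Config L} {D : Set (Config L)} {N : ℝ → ℕ} {s t : ℝ → ℝ}
    (hN : ∀ᶠ β in atTop, (N β : ℝ) < t β)
    (h1 : Tendsto (fun β => hitBy (avgOp L β h) D (N β) σ) atTop (nhds 1))
    (h0 : Tendsto (fun β => hitBy (avgOp L β h) D ⌊s β⌋₊ σ) atTop (nhds 0)) :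
    Tendsto (fun β => probTauIn β h σ D (Set.Ioo (s β) (t β))) atTop (nhds 1) := by
  have h2 := h1.sub h0
  rw [sub_zero] at h2
  refine tendsto_of_tendsto_of_tendsto_of_le_of_le' h2 tendsto_const_nhds ?_
    (Eventually.of_forall fun β => probTauIn_le_one σ D _)
  filter_upwards [hN] with β hβ
  exact le_probTauIn_Ioo σ D hβ

/-- If `A` is typically visited by time `M exp(βκ')` for `κ'` slightly above `κ`, while `B` is not,
and `A` is not visited before `exp(βκ - βε)`, then `A` is visited before `B` and at a time of
order `exp(βκ)`. -/
lemma tendsto_exit {σ : Config L} {A B : Set (Config L)} {κ g : ℝ} {M : ℕ} (hg : 0 < g)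
    (hA : ∀ κ', κ < κ' → κ' < κ + g → Tendsto (fun β =>
      hitBy (avgOp L β h) A (M * ⌊Real.exp (β * κ')⌋₊) σ) atTop (nhds 1))
    (hB : ∀ κ', κ < κ' → κ' < κ + g → Tendsto (fun β =>
      hitBy (avgOp L β h) B (M * ⌊Real.exp (β * κ')⌋₊) σ) atTop (nhds 0))
    (hlow : ∀ κ' < κ, Tendsto (fun β =>
      hitBy (avgOp L β h) A ⌊Real.exp (β * κ')⌋₊ σ) atTop (nhds 0)) :
    Tendsto (fun β => probHitBefore β h σ A B) atTop (nhds 1) ∧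
      ∀ ε : ℝ, 0 < ε → Tendsto (fun β => probTauIn β h σ A
        (Set.Ioo (Real.exp (β * κ - β * ε)) (Real.exp (β * κ + β * ε)))) atTop (nhds 1) := by
  refine ⟨tendsto_probHitBefore (hA (κ + g / 2) (by linarith) (by linarith))
    (hB (κ + g / 2) (by linarith) (by linarith)), fun ε hε => ?_⟩
  have hm : 0 < min ε g := lt_min hε hg
  have hmε := min_le_left ε g
  have hmg := min_le_right ε g
  refine tendsto_probTauIn ?_ (hA (κ + min ε g / 2) (by linarith) (by linarith)) ?_
  · have h1 : Tendsto (fun β : ℝ => Real.exp (β * (min ε g / 2))) atTop atTop :=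
      Real.tendsto_exp_atTop.comp (tendsto_id.atTop_mul_const (by linarith))
    filter_upwards [h1.eventually_gt_atTop (M : ℝ), eventually_ge_atTop 0] with β hβ hβ0
    push_cast
    calc (M : ℝ) * ⌊Real.exp (β * (κ + min ε g / 2))⌋₊
        ≤ M * Real.exp (β * (κ + min ε g / 2)) := by
          gcongr; exact Nat.floor_le (Real.exp_pos _).le
      _ < Real.exp (β * (min ε g / 2)) * Real.exp (β * (κ + min ε g / 2)) := by gcongr
      _ = Real.exp (β * κ + β * min ε g) := by rw [← Real.exp_add]; ring_nf
      _ ≤ Real.exp (β * κ + β * ε) := by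
          apply Real.exp_le_exp.mpr
          have := mul_le_mul_of_nonneg_left hmε hβ0
          linarith
  · simpa only [mul_sub] using hlow (κ - ε) (by linarith)

end Asymptotics

section Droplet

variable {L : ℕ} [NeZero L] {β h : ℝ} {U V : Site L → ℕ} {p : ZMod 2}

lemma Hi_pow_compl_le (hL : 2 ∣ L) (hβ : 0 ≤ β) {t : ℝ} {e : ZMod 2} {S : Set (Site L)}
    (hS : ∀ x ∉ S, nnS (cfg S) x + h ≤ -t) {σ : Config L} (hσ : σ ∈ Hi e S) (m : ℕ) :
    (avgOp L β h ^ m) (ind (Hi (e + m) S)ᶜ) σ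
      ≤ m * (Fintype.card (Site L) * Real.exp (-2 * β * t)) := by
  have h1 := (isMarkov_avgOp L β h).stay (I := fun k => Hi (e + k) S)
    (q := Fintype.card (Site L) * Real.exp (-2 * β * t))
    (fun k ω hω => by
      have := Hi_compl_le hL hβ hS hω
      rwa [add_assoc, ← Nat.cast_succ] at this) m 0 σ (by simpa using hσ)
  rwa [zero_add] at h1

lemma hitBy_seas_le (hL : 2 ∣ L) (hβ : 0 ≤ β) {c : Site L} {a b : ℕ} (ha : a + 2 ≤ L)
    (hb : b + 2 ≤ L) {σ : Config L} (hσ : ∀ x ∉ rect c a b, σ x = false) (N : ℕ) :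
    hitBy (avgOp L β h) (seas L h) N σ
      ≤ N * (Fintype.card (Site L) * Real.exp (-2 * β * (2 - h))) := by
  refine hitBy_le_of_invariant (isMarkov_avgOp L β h)
    (I := {η | ∀ x ∈ (rect c a b)ᶜ, η x = (fun _ => false) x}) (by positivity)
    (fun η hη => ?_) (fun η hη => notMem_seas hL ha hb hη) N σ hσ
  refine avgOp_ind_cylinder_compl_le (Real.exp_pos _).le fun x hx => flipP_le hβ ?_
  have h1 : nnS η x ≤ nnS (cfg (rect c a b)) x := by
    have hle : ∀ y, η y ≤ cfg (rect c a b) y := by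
      intro y
      by_cases hy : y ∈ rect c a b
      · simp [cfg, hy]
      · rw [hη y hy]; exact Bool.false_le _
    exact nnS_mono_of (hle _) (hle _) (hle _) (hle _)
  have h2 : nnS (cfg (rect c a b)) x ≤ -2 := by
    rw [rect_eq_box c (by omega) (by omega)] at hx ⊢
    exact box_nnS_le (isCoord_std hL c) ha hb hx
  simp [spin]; linarith

lemma tendsto_hitBy_seas (hL : 2 ∣ L) {c : Site L} {a b : ℕ} (ha : a + 2 ≤ L) (hb : b + 2 ≤ L)
    {σ : Config L} (hσ : ∀ x ∉ rect c a b, σ x = false) (M : ℕ) {κ : ℝ} (hκ : κ < 2 * (2 - h)) :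
    Tendsto (fun β => hitBy (avgOp L β h) (seas L h) (M * ⌊Real.exp (β * κ)⌋₊) σ) atTop
      (nhds 0) := by
  have h1 := (tendsto_floor_exp_mul_exp hκ).const_mul ((M : ℝ) * Fintype.card (Site L))
  rw [mul_zero] at h1
  refine squeeze_zero' (Eventually.of_forall fun β => hitBy_nonneg (isMarkov_avgOp L β h) _ _ _)
    ?_ h1
  filter_upwards [eventually_ge_atTop 0] with β hβ
  refine (hitBy_seas_le hL hβ ha hb hσ _).trans (le_of_eq ?_)
  push_cast; ring

lemma tendsto_hitBy_minusC {N : ℝ → ℕ} {σ : Config L}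
    (hN : Tendsto (fun β => (N β : ℝ) * Real.exp (-2 * β * (4 - h))) atTop (nhds 0))
    (h1 : Tendsto (fun β => (avgOp L β h ^ N β) (ind {minusC L}) σ) atTop (nhds 0)) :
    Tendsto (fun β => hitBy (avgOp L β h) {minusC L} (N β) σ) atTop (nhds 0) := by
  have h2 := h1.add (hN.const_mul (Fintype.card (Site L) : ℝ))
  rw [mul_zero, add_zero] at h2
  refine squeeze_zero' (Eventually.of_forall fun β => hitBy_nonneg (isMarkov_avgOp L β h) _ _ _)
    ?_ h2
  filter_upwards [eventually_ge_atTop 0] with β hβ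
  refine (hitBy_le_of_absorbing (isMarkov_avgOp L β h)
    (q := Fintype.card (Site L) * Real.exp (-2 * β * (4 - h))) (fun ω hω => ?_) (by positivity)
    (N β) σ).trans (le_of_eq (by ring))
  rw [Set.mem_singleton_iff.mp hω]
  exact minusC_compl_le hβ

lemma tendsto_Hi_empty (hL : 2 ∣ L) (h0 : 0 < h) (h2 : h < 2) (hc : IsCoord U V p) {a b : ℕ}
    (ha : 1 ≤ a) (haL : a + 2 ≤ L) (hbL : b + 2 ≤ L) {κ : ℝ}
    (hκ : 2 * h * ((a : ℝ) - 1) < κ) (hκ' : κ < 2 * (2 - h)) {e : ZMod 2} {σ : Config L}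
    (hσ : σ ∈ Hi e (box U V a b)) :
    Tendsto (fun β => (avgOp L β h ^ (2 * L * b * ⌊Real.exp (β * κ)⌋₊)) (ind (Hi e ∅)ᶜ) σ) atTop
      (nhds 0) := by
  have ha1 : (1 : ℝ) ≤ a := by exact_mod_cast ha
  have hw1 : stepW L ^ (2 * L) ≤ 1 := pow_le_one₀ stepW_pos.le stepW_le_one
  have hw : 0 < stepW L ^ (2 * L) := pow_pos stepW_pos _
  have hκ0 : 0 ≤ 2 * h * ((a : ℝ) - 1) := by nlinarith
  have hb0 : box U V a (b - b) = ∅ := by ext x; simp [box]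
  have h1 := (tendsto_floor_exp_mul_exp hκ').const_mul (2 * (L : ℝ) * Fintype.card (Site L))
  rw [mul_zero] at h1
  have key := tendsto_stages (Q := fun β => avgOp L β h ^ (2 * L))
    (fun β => (isMarkov_avgOp L β h).pow _) (G := fun i => Hi e (box U V a (b - i))) (S := b)
    (n := fun β => ⌊Real.exp (β * κ)⌋₊)
    (p := fun β => stepW L ^ (2 * L) * Real.exp (-β * (2 * h * ((a : ℝ) - 1)))) ?_ ?_ ?_
    (tendsto_one_sub_pow_floor hw hw1 hκ0 hκ) h1 hσ
  · simp only [hb0, ← pow_mul] at key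
    refine key.congr fun β => ?_
    rw [show 2 * L * b * ⌊Real.exp (β * κ)⌋₊ = 2 * L * (⌊Real.exp (β * κ)⌋₊ * b) by ring]
  · filter_upwards [eventually_ge_atTop 0] with β hβ
    refine ⟨by positivity, mul_le_one₀ hw1 (by positivity) ?_, by positivity⟩
    exact Real.exp_le_one_iff.mpr (by nlinarith)
  · filter_upwards [eventually_ge_atTop 0] with β hβ i hi m hm ω hω
    have h3 := Hi_pow_compl_le hL hβ (h := h) (t := 2 - h) (fun x hx => by
      have := box_nnS_le hc haL (by omega) hx
      linarith) hω (2 * (L * m))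
    rw [natCast_two_mul, ← mul_assoc, pow_mul] at h3
    refine h3.trans ?_
    have hm' : (m : ℝ) ≤ ⌊Real.exp (β * κ)⌋₊ := by exact_mod_cast hm
    push_cast
    calc 2 * (L : ℝ) * m * (Fintype.card (Site L) * Real.exp (-2 * β * (2 - h)))
        = 2 * (L : ℝ) * Fintype.card (Site L) * (m * Real.exp (-2 * β * (2 - h))) := by ring
      _ ≤ _ := by gcongr
  · filter_upwards [eventually_ge_atTop 0] with β hβ i hi ω hω
    have h3 := reach_peel hL hβ h0 h2 hc ha haL (b := b - (i + 1)) (by omega) e ω (by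
      rwa [show b - (i + 1) + 1 = b - i by omega])
    rw [((isMarkov_avgOp L β h).pow _).apply_compl]
    have h4 : Real.exp (-2 * β * h) ^ (a - 1) = Real.exp (-β * (2 * h * ((a : ℝ) - 1))) := by
      rw [← Real.exp_nat_mul, Nat.cast_sub ha]; ring_nf
    rw [h4] at h3
    linarith

end Droplet

section Supercritical

variable {L : ℕ} [NeZero L] {β h : ℝ} {R : Set (Site L)}

lemma tendsto_survival (hL : 2 ∣ L) (h0 : 0 < h) {c : Site L} {a b k : ℕ} (ha : a ≤ L)
    (hb : b ≤ L) (hka : k < a) (hkb : k < b) {e : ZMod 2} {σ : Config L}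
    (hσ : σ ∈ Lo e (rect c a b)) {κ : ℝ} (hκ : κ < 2 * (h * k)) :
    Tendsto (fun β => (avgOp L β h ^ ⌊Real.exp (β * κ)⌋₊)
      (ind (Lo (e + (⌊Real.exp (β * κ)⌋₊ : ZMod 2)) (rect c a b))ᶜ) σ) atTop (nhds 0) := by
  have h1 := ((tendsto_exp_neg_mul h0).const_mul (Fintype.card (Config L) : ℝ)).add
    ((tendsto_floor_exp_mul_exp hκ).const_mul
      ((Fintype.card (Site L) : ℝ) * Fintype.card (Config L)))
  rw [mul_zero, mul_zero, add_zero] at h1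
  refine squeeze_zero' (Eventually.of_forall fun β => ((isMarkov_avgOp L β h).pow _).ind_nonneg _ _)
    ?_ h1
  filter_upwards [eventually_ge_atTop 0] with β hβ
  refine (survival hL hβ h0 ha hb hka hkb (rect_eq_box c ha hb) hσ _).trans (le_of_eq ?_)
  rw [show -2 * β * h * (k : ℝ) = -2 * β * (h * k) by ring]
  ring

lemma minusC_notMem_Lo (hL : 2 ∣ L) {c : Site L} {a b : ℕ} (ha : 2 ≤ a) (haL : a ≤ L)
    (hb : 1 ≤ b) (hbL : b ≤ L) (e : ZMod 2) : minusC L ∉ Lo e (rect c a b) := by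
  have hc := isCoord_std hL c
  intro hm
  have hex : ∀ q e : ZMod 2, ∃ j : ℕ, j < 2 ∧ q + (j : ZMod 2) + (0 : ℕ) = e := by decide
  obtain ⟨j, hj, he⟩ := hex (par c) e
  obtain ⟨x, hx1, hx2⟩ := hc.surj j 0 (by omega) (by omega)
  have hp : par x = e := by
    rw [hc.par_eq x, hx1, hx2]; exact he
  have := hm x ⟨hp, by
    rw [rect_eq_box c haL hbL]
    exact ⟨by simp only [hx1]; omega, by simp only [hx2]; omega⟩⟩
  exact absurd this (by simp [minusC])

lemma tendsto_hitBy_minusC_of_Lo (hL : 2 ∣ L) (h0 : 0 < h) {c : Site L} {a b k : ℕ} (ha : 2 ≤ a)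
    (haL : a ≤ L) (hb : 2 ≤ b) (hbL : b ≤ L) (hka : k < a) (hkb : k < b) {e : ZMod 2}
    {σ : Config L} (hσ : σ ∈ Lo e (rect c a b)) {κ : ℝ} (hκ : κ < 2 * (h * k))
    (hκ' : κ < 2 * (4 - h)) :
    Tendsto (fun β => hitBy (avgOp L β h) {minusC L} ⌊Real.exp (β * κ)⌋₊ σ) atTop (nhds 0) := by
  refine tendsto_hitBy_minusC (tendsto_floor_exp_mul_exp hκ') ?_
  refine squeeze_zero (fun β => ((isMarkov_avgOp L β h).pow _).ind_nonneg _ _) (fun β => ?_)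
    (tendsto_survival hL h0 haL hbL hka hkb hσ hκ)
  refine ((isMarkov_avgOp L β h).pow _).mono _ _ (ind_mono ?_) σ
  rintro _ rfl
  exact minusC_notMem_Lo hL ha haL (by omega) hbL _

/-- Number of elementary growths needed to fill the torus from an `a × b` rectangle. -/
def fillSteps (L a b : ℕ) : ℕ := (L - b) + (L - a)

lemma tendsto_Lo_univ (hL : 2 ∣ L) (h0 : 0 < h) (h2 : h < 2) {c : Site L} {a b k : ℕ}
    (ha : 2 ≤ a) (haL : a ≤ L) (hb : 2 ≤ b) (hbL : b ≤ L) (hka : k < a) (hkb : k < b)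
    {e : ZMod 2} {σ : Config L} (hσ : σ ∈ Lo e (rect c a b)) {κ : ℝ} (hκ : 2 * (2 - h) < κ)
    (hκ' : κ < 2 * (h * k)) :
    Tendsto (fun β => (avgOp L β h ^ (2 * L * fillSteps L a b * ⌊Real.exp (β * κ)⌋₊))
      (ind (Lo e Set.univ)ᶜ) σ) atTop (nhds 0) := by
  have hc := isCoord_std hL c
  set U : Site L → ℕ := fun x => (x.1 - c.1).val with hU
  set V : Site L → ℕ := fun x => (x.2 - c.2).val with hV
  have hw1 : stepW L ^ (2 * L) ≤ 1 := pow_le_one₀ stepW_pos.le stepW_le_one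
  have hw : 0 < stepW L ^ (2 * L) := pow_pos stepW_pos _
  set A : ℕ → ℕ := fun i => a + (i - (L - b)) with hA
  set B : ℕ → ℕ := fun i => min L (b + i) with hB
  have hfill : box U V (A (fillSteps L a b)) (B (fillSteps L a b)) = Set.univ := by
    ext x
    have h3 := hc.lt_left x
    have h4 := hc.lt_right x
    simp only [box, Set.mem_ofPred_eq, hA, hB, fillSteps, Set.mem_univ, iff_true]
    omega
  have hstart : σ ∈ Lo e (box U V (A 0) (B 0)) := by
    rw [rect_eq_box c haL hbL] at hσ
    have hB0 : B 0 = b := by simp only [hB]; omega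
    have hA0 : A 0 = a := by simp only [hA]; omega
    rw [hA0, hB0]; exact hσ
  have h1 := ((tendsto_exp_neg_mul h0).const_mul (Fintype.card (Config L) : ℝ)).add
    ((tendsto_floor_exp_mul_exp hκ').const_mul
      (2 * (L : ℝ) * Fintype.card (Site L) * Fintype.card (Config L)))
  rw [mul_zero, mul_zero, add_zero] at h1
  have key := tendsto_stages (Q := fun β => avgOp L β h ^ (2 * L))
    (fun β => (isMarkov_avgOp L β h).pow _) (G := fun i => Lo e (box U V (A i) (B i)))
    (S := fillSteps L a b) (n := fun β => ⌊Real.exp (β * κ)⌋₊)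
    (p := fun β => stepW L ^ (2 * L) * Real.exp (-β * (2 * (2 - h)))) ?_ ?_ ?_
    (tendsto_one_sub_pow_floor hw hw1 (by linarith) hκ) h1 hstart
  · simp only [hfill, ← pow_mul] at key
    refine key.congr fun β => ?_
    rw [show 2 * L * fillSteps L a b * ⌊Real.exp (β * κ)⌋₊
      = 2 * L * (⌊Real.exp (β * κ)⌋₊ * fillSteps L a b) by ring]
  · filter_upwards [eventually_ge_atTop 0] with β hβ
    refine ⟨by positivity, mul_le_one₀ hw1 (by positivity) ?_, by positivity⟩
    exact Real.exp_le_one_iff.mpr (by nlinarith)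
  · filter_upwards [eventually_ge_atTop 0] with β hβ i hi m hm ω hω
    have hi' : i ≤ (L - b) + (L - a) := hi
    have h3 := survival hL hβ h0 (c := c) (a := A i) (b := B i) (k := k)
      (by simp only [hA]; omega) (by simp only [hB]; omega) (by simp only [hA]; omega)
      (by simp only [hB]; omega) rfl hω (2 * (L * m))
    rw [natCast_two_mul, ← mul_assoc, pow_mul] at h3
    refine h3.trans ?_
    have hm' : (m : ℝ) ≤ ⌊Real.exp (β * κ)⌋₊ := by exact_mod_cast hm
    refine add_le_add le_rfl ?_
    push_cast
    calc 2 * (L : ℝ) * m * Fintype.card (Site L)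
          * (Fintype.card (Config L) * Real.exp (-2 * β * h * k))
        = 2 * (L : ℝ) * Fintype.card (Site L) * Fintype.card (Config L)
          * (m * Real.exp (-2 * β * (h * k))) := by ring_nf
      _ ≤ _ := by gcongr
  · filter_upwards [eventually_ge_atTop 0] with β hβ i hi ω hω
    have hi' : i < (L - b) + (L - a) := hi
    have h3 : stepW L ^ (2 * L) * Real.exp (-2 * β * (2 - h))
        ≤ (avgOp L β h ^ (2 * L)) (ind (Lo e (box U V (A (i + 1)) (B (i + 1))))) ω := by
      by_cases hib : i < L - b
      · have e1 : A (i + 1) = A i := by simp only [hA]; omega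
        have e2 : B (i + 1) = B i + 1 := by simp only [hB]; omega
        rw [e1, e2]
        exact reach_grow hL hβ h0 h2 hc (by simp only [hA]; omega) (by simp only [hA]; omega)
          (by simp only [hB]; omega) (by simp only [hB]; omega) e ω hω
      · have e1 : A (i + 1) = A i + 1 := by simp only [hA]; omega
        have e2 : B (i + 1) = B i := by simp only [hB]; omega
        rw [e1, e2, ← box_swap]
        rw [← box_swap] at hω
        exact reach_grow hL hβ h0 h2 hc.swap (by simp only [hB]; omega) (by simp only [hB]; omega)
          (by simp only [hA]; omega) (by simp only [hA]; omega) e ω hω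
    rw [((isMarkov_avgOp L β h).pow _).apply_compl]
    rw [show -2 * β * (2 - h) = -β * (2 * (2 - h)) by ring] at h3
    linarith

lemma tendsto_Hi_empty_of_Hi_empty (hL : 2 ∣ L) {e : ZMod 2} {σ : Config L} (hσ : σ ∈ Hi e ∅)
    (M : ℕ) {κ : ℝ} (hκ : κ < 2 * (4 - h)) :
    Tendsto (fun β => (avgOp L β h ^ (2 * L * M * ⌊Real.exp (β * κ)⌋₊)) (ind (Hi e ∅)ᶜ) σ) atTop
      (nhds 0) := by
  have h1 := (tendsto_floor_exp_mul_exp hκ).const_mul (2 * (L : ℝ) * M * Fintype.card (Site L))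
  rw [mul_zero] at h1
  refine squeeze_zero' (Eventually.of_forall fun β => ((isMarkov_avgOp L β h).pow _).ind_nonneg _ _)
    ?_ h1
  filter_upwards [eventually_ge_atTop 0] with β hβ
  have h3 := Hi_pow_compl_le hL hβ (h := h) (t := 4 - h)
    (fun x _ => by rw [nnS_cfg_empty]; linarith) hσ (2 * (L * M * ⌊Real.exp (β * κ)⌋₊))
  rw [natCast_two_mul] at h3
  rw [show 2 * L * M * ⌊Real.exp (β * κ)⌋₊ = 2 * (L * M * ⌊Real.exp (β * κ)⌋₊) by ring]
  refine h3.trans (le_of_eq ?_)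
  push_cast; ring

lemma tendsto_hitBy_minusC_of_Lo_univ {M : ℕ} {e : ZMod 2} {σ : Config L} (hL : 2 ∣ L)
    {κ : ℝ} (hκ : κ < 2 * (4 - h))
    (h1 : Tendsto (fun β => (avgOp L β h ^ (M * ⌊Real.exp (β * κ)⌋₊)) (ind (Lo e Set.univ)ᶜ) σ)
      atTop (nhds 0)) :
    Tendsto (fun β => hitBy (avgOp L β h) {minusC L} (M * ⌊Real.exp (β * κ)⌋₊) σ) atTop
      (nhds 0) := by
  have h2 := (tendsto_floor_exp_mul_exp hκ).const_mul (M : ℝ)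
  rw [mul_zero] at h2
  refine tendsto_hitBy_minusC (h2.congr fun β => by push_cast; ring) ?_
  refine squeeze_zero (fun β => ((isMarkov_avgOp L β h).pow _).ind_nonneg _ _) (fun β => ?_) h1
  refine ((isMarkov_avgOp L β h).pow _).mono _ _ (ind_mono ?_) σ
  rintro _ rfl hm
  have hL1 := NeZero.pos L
  have hL2 := Nat.le_of_dvd hL1 hL
  exact minusC_notMem_Lo hL (c := 0) hL2 le_rfl hL1 le_rfl e fun x hx => hm x ⟨hx.1, trivial⟩

lemma Lo_univ_inter_subset (h0 : 0 < h) (e : ZMod 2) :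
    (Lo e Set.univ ∩ Lo (e + 1) Set.univ : Set (Config L)) ⊆ seas L h := by
  rintro σ ⟨h1, h3⟩
  have : σ = plusC L := by
    ext x
    have hor : ∀ p e : ZMod 2, p = e ∨ p = e + 1 := by decide
    rcases hor (par x) e with hx | hx
    · rw [h1 x ⟨hx, trivial⟩]; rfl
    · rw [h3 x ⟨hx, trivial⟩]; rfl
  rw [this]
  exact plusC_mem_seas h0

lemma Lo_univ_inter_Hi_subset (hL : 2 ∣ L) (h0 : 0 < h) (h2 : h < 2) (e : ZMod 2) :
    (Lo e Set.univ ∩ Hi (e + 1) ∅ : Set (Config L)) ⊆ seas L h := by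
  rintro σ ⟨h1, h3⟩
  have : σ = chess L e := by
    ext x
    have hor : ∀ p e : ZMod 2, p = e ∨ (p = e + 1 ∧ p ≠ e) := by decide
    rcases hor (par x) e with hx | ⟨hx, hx'⟩
    · rw [h1 x ⟨hx, trivial⟩]; simp [chess, hx]
    · rw [h3 x ⟨hx, fun hn => hn⟩]; simp [chess, hx']
  rw [this]
  exact chess_mem_seas hL h0 h2 e

omit [NeZero L] in
lemma Hi_empty_inter_subset :
    (Hi 0 ∅ ∩ Hi 1 ∅ : Set (Config L)) ⊆ {minusC L} := by
  rintro σ ⟨h1, h3⟩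
  ext x
  have hor : ∀ p : ZMod 2, p = 0 ∨ p = 1 := by decide
  rcases hor (par x) with hx | hx
  · rw [h1 x ⟨hx, fun hn => hn⟩]; rfl
  · rw [h3 x ⟨hx, fun hn => hn⟩]; rfl

end Supercritical

section Conclusion

variable {L : ℕ} [NeZero L] {h : ℝ} {c : Site L} {a b : ℕ} {ζ η : Config L} {e : ZMod 2}

omit [NeZero L] in
lemma exists_parity (hζ : ζ = plusC L ∨ ζ = chessE L ∨ ζ = chessO L) :
    ∃ e : ZMod 2, (∀ x ∈ subl L e, ζ x = true) ∧
      ((∀ x ∈ subl L (e + 1), ζ x = true) ∨ ∀ x ∈ subl L (e + 1), ζ x = false) := by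
  have hne : ∀ p e : ZMod 2, p = e + 1 → p ≠ e := by decide
  have hch : ∀ e : ZMod 2, (∀ x ∈ subl L e, chess L e x = true) ∧
      ((∀ x ∈ subl L (e + 1), chess L e x = true) ∨
        ∀ x ∈ subl L (e + 1), chess L e x = false) := fun e =>
    ⟨fun x hx => decide_eq_true hx, Or.inr fun x hx => decide_eq_false (hne _ _ hx)⟩
  rcases hζ with rfl | rfl | rfl
  · exact ⟨0, fun _ _ => rfl, Or.inl fun _ _ => rfl⟩
  · rw [← chess_zero]; exact ⟨0, hch 0⟩
  · rw [← chess_one]; exact ⟨1, hch 1⟩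

omit [NeZero L] in
lemma rectCfg_mem_Lo (he : ∀ x ∈ subl L e, ζ x = true) (hη : η = rectCfg (minusC L) ζ c a b) :
    η ∈ Lo e (rect c a b) := by
  intro x hx
  rw [hη, rectCfg, if_pos hx.2, he x hx.1]

omit [NeZero L] in
lemma rectCfg_eq_false (hη : η = rectCfg (minusC L) ζ c a b) :
    ∀ x ∉ rect c a b, η x = false := by
  intro x hx
  rw [hη, rectCfg, if_neg hx]; rfl

lemma two_lt_mul_lam (h0 : 0 < h) : 2 < h * (lam h : ℝ) := by
  have h1 := Nat.lt_floor_add_one (2 / h)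
  rw [div_lt_iff₀ h0] at h1
  rw [lam]; push_cast; linarith

lemma mul_lt_two_of_lt_lam (h0 : 0 < h) (hz : ∀ z : ℤ, (z : ℝ) ≠ 2 / h) {ℓ : ℕ}
    (hℓ : ℓ < lam h) : h * (ℓ : ℝ) < 2 := by
  have h1 : (ℓ : ℝ) ≤ 2 / h :=
    (Nat.le_floor_iff (by positivity)).mp (Nat.lt_succ_iff.mp hℓ)
  have h2 : (ℓ : ℝ) < 2 / h := lt_of_le_of_ne h1 (by exact_mod_cast hz ℓ)
  rw [lt_div_iff₀ h0] at h2
  linarith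

lemma subcritical (hL : 2 ∣ L) (h0 : 0 < h) (h2 : h < 2) (hz : ∀ z : ℤ, (z : ℝ) ≠ 2 / h)
    (ha : 2 ≤ a) (hb : 2 ≤ b) (haL : a + 2 ≤ L) (hbL : b + 2 ≤ L)
    (he : ∀ x ∈ subl L e, ζ x = true) (hη : η = rectCfg (minusC L) ζ c a b) {ℓ : ℕ}
    (hℓ : ℓ = min a b) (hlt : ℓ < lam h) :
    Tendsto (fun β : ℝ => probHitBefore β h η {minusC L} (seas L h)) atTop (nhds 1) ∧
      ∀ ε : ℝ, 0 < ε → Tendsto (fun β : ℝ => probTauIn β h η {minusC L}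
        (Set.Ioo (Real.exp (2 * β * h * ((ℓ : ℝ) - 1) - β * ε))
          (Real.exp (2 * β * h * ((ℓ : ℝ) - 1) + β * ε)))) atTop (nhds 1) := by
  have hout := rectCfg_eq_false hη
  have hℓ2 : h * (ℓ : ℝ) < 2 := mul_lt_two_of_lt_lam h0 hz hlt
  have hHi : ∀ e', η ∈ Hi e' (box (fun x : Site L => (x.1 - c.1).val)
      (fun x => (x.2 - c.2).val) a b) := by
    intro e' x hx
    rw [← rect_eq_box c (by omega) (by omega)] at hx
    exact hout x hx.2
  have hempty : ∀ e' κ', 2 * h * ((ℓ : ℝ) - 1) < κ' → κ' < 2 * (2 - h) →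
      Tendsto (fun β => (avgOp L β h ^ (2 * L * max a b * ⌊Real.exp (β * κ')⌋₊))
        (ind (Hi e' ∅)ᶜ) η) atTop (nhds 0) := by
    intro e' κ' hκ hκ'
    rcases le_total a b with hab | hab
    · rw [min_eq_left hab] at hℓ
      rw [max_eq_right hab]
      subst hℓ
      exact tendsto_Hi_empty hL h0 h2 (isCoord_std hL c) (by omega) haL hbL hκ hκ' (hHi e')
    · rw [min_eq_right hab] at hℓ
      rw [max_eq_left hab]
      subst hℓ
      exact tendsto_Hi_empty hL h0 h2 (isCoord_std hL c).swap (by omega) hbL haL hκ hκ'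
        (by rw [box_swap]; exact hHi e')
  have key := tendsto_exit (h := h) (σ := η) (A := {minusC L}) (B := seas L h)
    (κ := 2 * h * ((ℓ : ℝ) - 1)) (g := 2 * (2 - h) - 2 * h * ((ℓ : ℝ) - 1)) (M := 2 * L * max a b)
    (by linarith) (fun κ' hκ hκ' => ?_) (fun κ' hκ hκ' => ?_) (fun κ' hκ => ?_)
  · refine ⟨key.1, fun ε hε => ?_⟩
    have hmul : ∀ β : ℝ, 2 * β * h * ((ℓ : ℝ) - 1) = β * (2 * h * ((ℓ : ℝ) - 1)) := fun β => by ring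
    simp only [hmul]
    exact key.2 ε hε
  · have hκ2 : κ' < 2 * (2 - h) := by linarith
    exact tendsto_hitBy_of_compl (fun β => isMarkov_avgOp L β h)
      (tendsto_compl_of_inter (fun β => isMarkov_avgOp L β h) Hi_empty_inter_subset
        (hempty 0 κ' hκ hκ2) (hempty 1 κ' hκ hκ2))
  · exact tendsto_hitBy_seas hL haL hbL hout _ (by linarith)
  · refine tendsto_hitBy_minusC_of_Lo hL h0 (k := ℓ - 1) ha (by omega) hb (by omega) (by omega)
      (by omega) (rectCfg_mem_Lo he hη) ?_ (by linarith)
    rw [Nat.cast_sub (by omega)]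
    push_cast; linarith

lemma supercritical (hL : 2 ∣ L) (h0 : 0 < h) (h2 : h < 2)
    (ha : 2 ≤ a) (hb : 2 ≤ b) (haL : a + 2 ≤ L) (hbL : b + 2 ≤ L)
    (he : ∀ x ∈ subl L e, ζ x = true)
    (he' : (∀ x ∈ subl L (e + 1), ζ x = true) ∨ ∀ x ∈ subl L (e + 1), ζ x = false)
    (hη : η = rectCfg (minusC L) ζ c a b) {ℓ : ℕ} (hℓ : ℓ = min a b) (hle : lam h ≤ ℓ) :
    Tendsto (fun β : ℝ => probHitBefore β h η (seas L h) {minusC L}) atTop (nhds 1) ∧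
      ∀ ε : ℝ, 0 < ε → Tendsto (fun β : ℝ => probTauIn β h η (seas L h)
        (Set.Ioo (Real.exp (2 * β * (2 - h) - β * ε))
          (Real.exp (2 * β * (2 - h) + β * ε)))) atTop (nhds 1) := by
  have hout := rectCfg_eq_false hη
  have hlam := two_lt_mul_lam h0
  have hlam1 : 1 ≤ lam h := Nat.le_add_left _ _
  have hk : 2 - h < h * ((lam h - 1 : ℕ) : ℝ) := by
    rw [Nat.cast_sub hlam1]; push_cast; linarith
  have hfull : ∀ e', (∀ x ∈ subl L e', ζ x = true) → ∀ κ', 2 * (2 - h) < κ' →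
      κ' < 2 * (h * ((lam h - 1 : ℕ) : ℝ)) →
      Tendsto (fun β => (avgOp L β h ^ (2 * L * fillSteps L a b * ⌊Real.exp (β * κ')⌋₊))
        (ind (Lo e' Set.univ)ᶜ) η) atTop (nhds 0) := fun e' hζ κ' hκ hκ' =>
    tendsto_Lo_univ hL h0 h2 ha (by omega) hb (by omega) (by omega) (by omega)
      (rectCfg_mem_Lo hζ hη) hκ hκ'
  have key := tendsto_exit (h := h) (σ := η) (A := seas L h) (B := {minusC L})
    (κ := 2 * (2 - h)) (g := min 1 (2 * (h * ((lam h - 1 : ℕ) : ℝ)) - 2 * (2 - h)))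
    (M := 2 * L * fillSteps L a b) (lt_min one_pos (by linarith)) (fun κ' hκ hκ' => ?_)
    (fun κ' hκ hκ' => ?_) (fun κ' hκ => ?_)
  · refine ⟨key.1, fun ε hε => ?_⟩
    have hmul : ∀ β : ℝ, 2 * β * (2 - h) = β * (2 * (2 - h)) := fun β => by ring
    simp only [hmul]
    exact key.2 ε hε
  · have m1 := min_le_left (1 : ℝ) (2 * (h * ((lam h - 1 : ℕ) : ℝ)) - 2 * (2 - h))
    have m2 := min_le_right (1 : ℝ) (2 * (h * ((lam h - 1 : ℕ) : ℝ)) - 2 * (2 - h))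
    have hM := fun β => isMarkov_avgOp L β h
    have f1 := hfull e he κ' hκ (by linarith)
    rcases he' with he' | he'
    · exact tendsto_hitBy_of_compl hM (tendsto_compl_of_inter hM (Lo_univ_inter_subset h0 e) f1
        (hfull _ he' κ' hκ (by linarith)))
    · refine tendsto_hitBy_of_compl hM (tendsto_compl_of_inter hM
        (Lo_univ_inter_Hi_subset hL h0 h2 e) f1
        (tendsto_Hi_empty_of_Hi_empty hL (fun x hx => ?_) _ (by linarith)))
      by_cases hxR : x ∈ rect c a b
      · rw [hη, rectCfg, if_pos hxR]; exact he' x hx.1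
      · exact hout x hxR
  · have m1 := min_le_left (1 : ℝ) (2 * (h * ((lam h - 1 : ℕ) : ℝ)) - 2 * (2 - h))
    have m2 := min_le_right (1 : ℝ) (2 * (h * ((lam h - 1 : ℕ) : ℝ)) - 2 * (2 - h))
    exact tendsto_hitBy_minusC_of_Lo_univ hL (by linarith) (hfull e he κ' hκ (by linarith))
  · simpa using tendsto_hitBy_seas hL haL hbL hout 1 hκ

end Conclusion
/-- Proposition 3.4: subcritical/supercritical behaviour of a
single rectangular droplet of `+1` or chessboard in the sea of minuses. -/
theorem single_droplet_in_minus_sea :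
    ∃ h₀ : ℝ, 0 < h₀ ∧ h₀ ≤ 2 ∧
    ∀ h : ℝ, 0 < h → h < h₀ → (∀ z : ℤ, (z : ℝ) ≠ 2 / h) →
    ∃ L₀ : ℕ, ∀ (L : ℕ) [NeZero L], Even L → L₀ ≤ L →
      ∀ ζ : Config L, (ζ = plusC L ∨ ζ = chessE L ∨ ζ = chessO L) →
      ∀ (c : Site L) (a b : ℕ), 2 ≤ min a b → max a b ≤ L - 2 →
      ∀ η : Config L, η = rectCfg (minusC L) ζ c a b →
      ∀ ℓ : ℕ, ℓ = min a b →
        (ℓ < lam h →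
          Tendsto (fun β : ℝ => probHitBefore β h η {minusC L}
              ({σ | SeaChessAny h σ} ∪ {σ | SeaPlus h σ})) atTop (nhds 1) ∧
          ∀ ε : ℝ, 0 < ε →
            Tendsto (fun β : ℝ => probTauIn β h η {minusC L}
                (Set.Ioo (Real.exp (2 * β * h * ((ℓ : ℝ) - 1) - β * ε))
                  (Real.exp (2 * β * h * ((ℓ : ℝ) - 1) + β * ε))))
              atTop (nhds 1)) ∧
        (lam h ≤ ℓ →
          Tendsto (fun β : ℝ => probHitBefore β h η
              ({σ | SeaChessAny h σ} ∪ {σ | SeaPlus h σ}) {minusC L}) atTop (nhds 1) ∧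
          ∀ ε : ℝ, 0 < ε →
            Tendsto (fun β : ℝ => probTauIn β h η
                ({σ | SeaChessAny h σ} ∪ {σ | SeaPlus h σ})
                (Set.Ioo (Real.exp (2 * β * (2 - h) - β * ε))
                  (Real.exp (2 * β * (2 - h) + β * ε))))
              atTop (nhds 1)) := by
  refine ⟨2, by norm_num, le_rfl, fun h h0 h2 hz => ⟨0, ?_⟩⟩
  intro L _ hL _ ζ hζ c a b hmin hmax η hη ℓ hℓ
  have ha : 2 ≤ a := hmin.trans (min_le_left _ _)
  have hb : 2 ≤ b := hmin.trans (min_le_right _ _)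
  have haL : a + 2 ≤ L := by omega
  have hbL : b + 2 ≤ L := by omega
  obtain ⟨e, he, he'⟩ := exists_parity hζ
  exact ⟨fun hlt => subcritical hL.two_dvd h0 h2 hz ha hb haL hbL he hη hℓ hlt,
    fun hle => supercritical hL.two_dvd h0 h2 ha hb haL hbL he he' hη hℓ hle⟩

end PCA
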